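/- arXiv:2309.12947 — 2 statements merged into one kernel-verified Lean document; each statement's English description precedes it below -/
import Mathlib

section
/- Let n ≥ 2, p > 0, and let f : B → ℝⁿ be a K-quasiregular mapping with f ∈ H^p. Then f satisfies the growth estimate |f(x)|^p ≤ C ‖f‖_{H^p}^p / (1−|x|)^{n−1} for all x ∈ B, where the constant C depends only on p, n and K. -/
open MeasureTheory Metric Set Filter
open scoped ENNReal NNReal Topology Classical

noncomputable section

abbrev Vec (n : ℕ) := EuclideanSpace ℝ (Fin n)

/-- The open unit ball in `ℝⁿ`. -/
def unitBall (n : ℕ) : Set (Vec n) := Metric.ball 0 1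

/-- The unit sphere `S^{n-1}` in `ℝⁿ`. -/
def unitSphere (n : ℕ) : Set (Vec n) := Metric.sphere 0 1

/-- Surface measure on the unit sphere, modelled by `(n-1)`-dimensional
Hausdorff measure restricted to the sphere. -/
def sphMeasure (n : ℕ) : Measure (Vec n) := (μH[(n : ℝ) - 1]).restrict (unitSphere n)

/-- `f` is `K`-quasiregular on the unit ball. -/
def IsQR (n : ℕ) (K : ℝ) (f : Vec n → Vec n) : Prop :=
  ContinuousOn f (unitBall n) ∧
  (∀ x ∈ unitBall n, DifferentiableAt ℝ f x) ∧
  (∀ᵐ x ∂(volume.restrict (unitBall n)),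
    ‖fderiv ℝ f x‖ ^ n ≤ K * (fderiv ℝ f x).det)

/-- The conformal automorphism `T_x` of the unit ball (with `T_0 = id`). -/
def mobiusT (n : ℕ) (x : Vec n) (y : Vec n) : Vec n :=
  if x = 0 then y
  else (‖x‖ ^ 2 * ‖y - (‖x‖ ^ 2)⁻¹ • x‖ ^ 2)⁻¹ •
    ((1 - ‖x‖ ^ 2) • (y - x) - ‖y - x‖ ^ 2 • x)

/-- The Miniowitz class (Min) with constants `C₀, α`. -/
def InMiniowitz (n : ℕ) (C₀ α : ℝ) (f : Vec n → Vec n) : Prop :=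
  ∀ x ∈ unitBall n, ∀ y ∈ unitBall n,
    C₀⁻¹ * ((1 - ‖y‖) / (1 + ‖y‖)) ^ α ≤ ‖f (mobiusT n (-x) y)‖ / ‖f (mobiusT n (-x) 0)‖ ∧
    ‖f (mobiusT n (-x) y)‖ / ‖f (mobiusT n (-x) 0)‖ ≤ C₀ * ((1 + ‖y‖) / (1 - ‖y‖)) ^ α

/-- The multiplicity condition (M) with exponent `a` and constant `C₁`. -/
def MultCond (n : ℕ) (a C₁ : ℝ) (f : Vec n → Vec n) : Prop :=
  ∀ x ∈ unitBall n, ∀ r : ℝ, 0 < r → r < 1 → ∀ y : Vec n,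
    (({z ∈ Metric.ball (0 : Vec n) r | f (mobiusT n (-x) z) = y}).encard : ℝ≥0∞) ≤
      ENNReal.ofReal (C₁ / (1 - r) ^ a)

/-- The non-tangential region `Γ(ω)` with aperture parameter `κ`. -/
def ntRegion (n : ℕ) (κ : ℝ) (ω : Vec n) : Set (Vec n) :=
  {x ∈ unitBall n | ‖x - ω‖ < (1 + κ) * (1 - ‖x‖)}

/-- The non-tangential maximal function `f*`. -/
def ntMax (n : ℕ) (κ : ℝ) (f : Vec n → Vec n) (ω : Vec n) : ℝ≥0∞ :=
  ⨆ x ∈ ntRegion n κ ω, ENNReal.ofReal ‖f x‖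

/-- `f` has the non-tangential limit `L` at `ω`. -/
def HasNTLimit (n : ℕ) (κ : ℝ) (f : Vec n → Vec n) (ω L : Vec n) : Prop :=
  Filter.Tendsto f (𝓝[ntRegion n κ ω] ω) (𝓝 L)

/-- The `p`-th mean of `f` on the sphere of radius `r`. -/
def hardyMean (n : ℕ) (p : ℝ) (f : Vec n → Vec n) (r : ℝ) : ℝ≥0∞ :=
  (sphMeasure n (unitSphere n))⁻¹ *
    ∫⁻ ω, ENNReal.ofReal (‖f (r • ω)‖ ^ p) ∂(sphMeasure n)

/-- The Hardy `H^p` norm of `f` on the unit ball. -/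
def hardyNorm (n : ℕ) (p : ℝ) (f : Vec n → Vec n) : ℝ≥0∞ :=
  (⨆ r ∈ Set.Ioo (0 : ℝ) 1, hardyMean n p f r) ^ (1 / p)

/-- `f` belongs to the Hardy space `H^p`. -/
def MemHp (n : ℕ) (p : ℝ) (f : Vec n → Vec n) : Prop := hardyNorm n p f < ⊤

/-- The `L^p(σ)` norm of a boundary function on the unit sphere. -/
def lpSphere (n : ℕ) (p : ℝ) (g : Vec n → Vec n) : ℝ≥0∞ :=
  (∫⁻ ω, ENNReal.ofReal (‖g ω‖ ^ p) ∂(sphMeasure n)) ^ (1 / p)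

/-- The `L^p(σ)` norm of the non-tangential maximal function `f*`. -/
def ntMaxLp (n : ℕ) (κ p : ℝ) (f : Vec n → Vec n) : ℝ≥0∞ :=
  (∫⁻ ω, (ntMax n κ f ω) ^ p ∂(sphMeasure n)) ^ (1 / p)

/-- `μ` is a Carleson measure on the unit ball with constant `c`. -/
def IsCarleson (n : ℕ) (c : ℝ) (μ : Measure (Vec n)) : Prop :=
  ∀ ω ∈ unitSphere n, ∀ r : ℝ, 0 < r →
    μ (unitBall n ∩ Metric.ball ω r) ≤ ENNReal.ofReal c * ENNReal.ofReal r ^ ((n : ℝ) - 1)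

/-- `μ` is an `α`-Carleson measure on the unit ball with constant `γ`. -/
def IsAlphaCarleson (n : ℕ) (α γ : ℝ) (μ : Measure (Vec n)) : Prop :=
  ∀ ω ∈ unitSphere n, ∀ r : ℝ, 0 < r →
    μ (unitBall n ∩ Metric.ball ω r) ≤
      ENNReal.ofReal γ * ENNReal.ofReal r ^ (α * ((n : ℝ) - 1))

section NullLagrangian

variable {E : Type*} [NormedAddCommGroup E] [NormedSpace ℝ E] [FiniteDimensional ℝ E]

/-- The determinant is a fixed linear combination of the values `det (1 + s A)` at small `s`. -/
theorem exists_det_eq_sum_det_id_add_smul {s₀ : ℝ} (hs₀ : 0 < s₀) :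
    ∃ (N : ℕ) (s w : Fin N → ℝ), (∀ j, 0 < s j ∧ s j < s₀) ∧
      ∀ A : E →L[ℝ] E, A.det = ∑ j, w j * (ContinuousLinearMap.id ℝ E + s j • A).det := by
  set d := Module.finrank ℝ E
  set t : Fin (d + 1) → ℝ := fun j => 1 / s₀ + 1 + (j : ℝ) with ht
  have htpos : ∀ j, 1 / s₀ < t j := fun j => by
    simp only [ht]
    have : (0 : ℝ) ≤ (j : ℕ) := by positivity
    linarith
  have h0 : 0 < 1 / s₀ := by positivity
  have htinj : Function.Injective t := fun i j hij => by
    simp only [ht] at hij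
    have : ((i : ℕ) : ℝ) = (j : ℕ) := by linarith
    exact Fin.ext (by exact_mod_cast this)
  refine ⟨d + 1, fun j => (t j)⁻¹,
    fun j => (Lagrange.basis Finset.univ t j).eval 0 * t j ^ d, fun j => ⟨?_, ?_⟩, fun A => ?_⟩
  · exact inv_pos.2 (h0.trans (htpos j))
  · rw [inv_lt_comm₀ (h0.trans (htpos j)) hs₀, ← one_div]
    exact htpos j
  · set P := (-(A : E →ₗ[ℝ] E)).charpoly with hP
    have hev : ∀ r : ℝ, P.eval r = LinearMap.det (algebraMap ℝ (E →ₗ[ℝ] E) r + (A : E →ₗ[ℝ] E)) := fun r => by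
      rw [hP, LinearMap.eval_charpoly, sub_neg_eq_add]
    have hdeg : P.degree < (Finset.univ : Finset (Fin (d + 1))).card := by
      rw [Polynomial.degree_eq_natDegree (LinearMap.charpoly_monic _).ne_zero,
        LinearMap.charpoly_natDegree]
      rw [Finset.card_univ, Fintype.card_fin]
      exact_mod_cast Nat.lt_succ_self d
    have := congrArg (Polynomial.eval 0) (Lagrange.eq_interpolate (v := t) htinj.injOn hdeg)
    rw [hev, Lagrange.interpolate_apply, Polynomial.eval_finsetSum] at this
    simp only [map_zero, zero_add] at this
    rw [ContinuousLinearMap.det, this]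
    refine Finset.sum_congr rfl fun j _ => ?_
    have htj : t j ≠ 0 := (h0.trans (htpos j)).ne'
    rw [Polynomial.eval_mul, Polynomial.eval_C, hev]
    have : algebraMap ℝ (E →ₗ[ℝ] E) (t j) + (A : E →ₗ[ℝ] E)
        = t j • ((ContinuousLinearMap.id ℝ E + (t j)⁻¹ • A : E →L[ℝ] E) : E →ₗ[ℝ] E) := by
      ext x
      simp [smul_smul, htj, Module.algebraMap_end_apply]
    rw [this, LinearMap.det_smul, ContinuousLinearMap.det]
    ring

variable [MeasurableSpace E] [BorelSpace E] (μ : Measure E) [μ.IsAddHaarMeasure]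

/-- A small `C¹` perturbation of the identity supported in a ball is volume preserving on average. -/
theorem exists_forall_integral_det_id_add_smul_eq {G : E → E} (hG : ContDiff ℝ 1 G)
    (hc : HasCompactSupport G) {R : ℝ} (hR : Function.support G ⊆ ball 0 R) :
    ∃ s₀ > 0, ∀ s : ℝ, 0 < s → s < s₀ →
      ∫ x in ball 0 R, (ContinuousLinearMap.id ℝ E + s • fderiv ℝ G x).det ∂μ
        = μ.real (ball 0 R) := by
  obtain ⟨L, hL⟩ := ContDiff.lipschitzWith_of_hasCompactSupport hc hG one_ne_zero
  have hdet : ∀ᶠ A : E →L[ℝ] E in 𝓝 (ContinuousLinearMap.id ℝ E), 0 < A.det := by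
    apply ContinuousLinearMap.continuous_det.continuousAt.eventually_mem
    apply isOpen_Ioi.mem_nhds
    simp [ContinuousLinearMap.det]
  obtain ⟨δ, hδ, hdet⟩ := Metric.eventually_nhds_iff.1 hdet
  have hL1 : (0 : ℝ) < L + 1 := by positivity
  refine ⟨min (1 / (L + 1)) (δ / (L + 1)), by positivity, fun s hs hs' => ?_⟩
  have hs1 : s * (L + 1) < 1 := by
    have := hs'.trans_le (min_le_left _ _)
    rwa [lt_div_iff₀ hL1] at this
  have hs2 : s * (L + 1) < δ := by
    have := hs'.trans_le (min_le_right _ _)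
    rwa [lt_div_iff₀ hL1] at this
  set φ : E → E := fun x => x + s • G x with hφ
  have happ : ApproximatesLinearOn φ ((ContinuousLinearEquiv.refl ℝ E : E ≃L[ℝ] E) : E →L[ℝ] E)
      univ (s.toNNReal * L) := by
    intro x _ y _
    have h1 : φ x - φ y - ((ContinuousLinearEquiv.refl ℝ E : E ≃L[ℝ] E) : E →L[ℝ] E) (x - y)
        = s • (G x - G y) := by
      simp only [hφ, smul_sub, ContinuousLinearEquiv.coe_refl, ContinuousLinearMap.id_apply]
      abel
    rw [h1, norm_smul, Real.norm_of_nonneg hs.le, NNReal.coe_mul, Real.coe_toNNReal s hs.le,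
      mul_assoc]
    gcongr
    simpa [dist_eq_norm] using hL.dist_le_mul x y
  have hc' : Subsingleton E ∨ s.toNNReal * L <
      ‖((ContinuousLinearEquiv.refl ℝ E : E ≃L[ℝ] E).symm : E →L[ℝ] E)‖₊⁻¹ := by
    rcases subsingleton_or_nontrivial E with h | h
    · exact Or.inl h
    · right
      have : ‖((ContinuousLinearEquiv.refl ℝ E : E ≃L[ℝ] E).symm : E →L[ℝ] E)‖₊ = 1 := by
        simp [ContinuousLinearMap.nnnorm_id]
      rw [this, inv_one, ← NNReal.coe_lt_coe, NNReal.coe_mul, Real.coe_toNNReal s hs.le]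
      push_cast
      nlinarith
  have hinj : Function.Injective φ := by
    have := happ.injective hc'
    exact fun x y hxy => congrArg Subtype.val
      (@this ⟨x, mem_univ x⟩ ⟨y, mem_univ y⟩ (by simpa using hxy))
  have hsurj : Function.Surjective φ := happ.surjective hc'
  have hout : φ '' (ball 0 R)ᶜ = (ball 0 R)ᶜ := by
    have : ∀ x ∈ (ball (0 : E) R)ᶜ, φ x = x := by
      intro x hx
      have : G x = 0 := by
        by_contra h
        exact hx (hR h)
      simp [hφ, this]
    rw [Set.image_congr this, image_id']
  have himg : φ '' ball 0 R = ball 0 R := by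
    have := Set.image_compl_eq (s := (ball (0 : E) R)ᶜ) ⟨hinj, hsurj⟩
    rwa [compl_compl, hout, compl_compl] at this
  have hder : ∀ x, HasFDerivAt φ (ContinuousLinearMap.id ℝ E + s • fderiv ℝ G x) x := fun x =>
    (hasFDerivAt_id x).add
      (((hG.differentiable one_ne_zero) x).hasFDerivAt.const_smul s)
  have hcv := integral_image_eq_integral_abs_det_fderiv_smul μ (s := ball 0 R) measurableSet_ball
    (fun x _ => (hder x).hasFDerivWithinAt) hinj.injOn (fun _ => (1 : ℝ))
  rw [himg] at hcv
  simp only [smul_eq_mul, mul_one, integral_const, measureReal_restrict_apply_univ] at hcv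
  rw [hcv]
  refine integral_congr_ae (Eventually.of_forall fun x => ?_)
  simp only
  rw [abs_of_pos]
  apply hdet
  rw [dist_eq_norm, add_sub_cancel_left, norm_smul, Real.norm_of_nonneg hs.le]
  have : ‖fderiv ℝ G x‖ ≤ L := norm_fderiv_le_of_lipschitz ℝ hL
  nlinarith

/-- The integral of the Jacobian of a compactly supported `C¹` map vanishes. -/
theorem integral_det_fderiv_eq_zero_of_contDiff [Nontrivial E] {G : E → E}
    (hG : ContDiff ℝ 1 G) (hc : HasCompactSupport G) :
    ∫ x, (fderiv ℝ G x).det ∂μ = 0 := by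
  obtain ⟨R, hR⟩ := hc.isCompact.isBounded.subset_ball (0 : E)
  have hsupp : Function.support G ⊆ ball 0 R := (subset_tsupport G).trans hR
  obtain ⟨s₀, hs₀, hs⟩ := exists_forall_integral_det_id_add_smul_eq μ hG hc hsupp
  obtain ⟨N, s, w, hsj, hw⟩ := exists_det_eq_sum_det_id_add_smul (E := E) hs₀
  have hcont : Continuous (fderiv ℝ G) := hG.continuous_fderiv one_ne_zero
  have h1 : ∫ x, (fderiv ℝ G x).det ∂μ = ∫ x in ball 0 R, (fderiv ℝ G x).det ∂μ := by
    refine (setIntegral_eq_integral_of_forall_compl_eq_zero fun x hx => ?_).symm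
    have hx' : fderiv ℝ G x = 0 := by
      by_contra h
      exact hx (hR (support_fderiv_subset ℝ h))
    rw [hx', ContinuousLinearMap.det, ContinuousLinearMap.toLinearMap_zero, LinearMap.det_zero]
    simp [Module.finrank_pos.ne']
  have hint : ∀ j, IntegrableOn
      (fun x => w j * (ContinuousLinearMap.id ℝ E + s j • fderiv ℝ G x).det) (ball 0 R) μ := by
    intro j
    have : Continuous fun x => w j * (ContinuousLinearMap.id ℝ E + s j • fderiv ℝ G x).det :=
      continuous_const.mul (ContinuousLinearMap.continuous_det.comp (by fun_prop))
    exact (this.continuousOn.integrableOn_compact (isCompact_closedBall 0 R)).mono_set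
      ball_subset_closedBall
  have h0 : (0 : ℝ) = ∑ j, w j := by
    have := hw 0
    rw [ContinuousLinearMap.det, ContinuousLinearMap.toLinearMap_zero, LinearMap.det_zero] at this
    simpa [Module.finrank_pos.ne', ContinuousLinearMap.det] using this
  rw [h1]
  simp_rw [hw (fderiv ℝ G _)]
  rw [integral_finsetSum _ fun j _ => hint j]
  simp_rw [integral_const_mul]
  rw [Finset.sum_congr rfl fun j _ => by rw [hs (s j) (hsj j).1 (hsj j).2], ← Finset.sum_mul, ← h0,
    zero_mul]

end NullLagrangian

section Mollification

/-- The `L^p` norm of a bounded function vanishing outside a set. -/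
theorem eLpNorm_le_of_forall_notMem_eq_zero {α G : Type*} [MeasurableSpace α] {μ : Measure α}
    [NormedAddCommGroup G] {q : α → G} {s : Set α} (hs : ∀ x, x ∉ s → q x = 0) {C : ℝ}
    (hC : ∀ x, ‖q x‖ ≤ C) {p : ℝ≥0∞} :
    eLpNorm q p μ ≤ μ s ^ p.toReal⁻¹ * ENNReal.ofReal C := by
  have h : Function.support q ⊆ s := fun x hx => by_contra fun h => hx (hs x h)
  rw [← eLpNorm_restrict_eq_of_support_subset h]
  have := eLpNorm_le_of_ae_bound (p := p) (μ := μ.restrict s) (Eventually.of_forall hC)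
  rwa [Measure.restrict_apply_univ] at this

open scoped Convolution

variable {E : Type*} [NormedAddCommGroup E] [NormedSpace ℝ E] [FiniteDimensional ℝ E]
  [HasContDiffBump E] [MeasurableSpace E] [BorelSpace E] {μ : Measure E} [μ.IsAddHaarMeasure]
  {F : Type*} [NormedAddCommGroup F] [NormedSpace ℝ F]

/-- Convolution with a normalized bump function is a contraction of `L^p`. -/
theorem ContDiffBump.eLpNorm_normed_convolution_le (φ : ContDiffBump (0 : E)) {g : E → F}
    (hg : StronglyMeasurable g) {p : ℝ≥0∞} (hp1 : 1 ≤ p) (hp : p ≠ ⊤) :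
    eLpNorm (φ.normed μ ⋆[ContinuousLinearMap.lsmul ℝ ℝ, μ] g) p μ ≤ eLpNorm g p μ := by
  borelize F
  set ρ : E → ℝ≥0∞ := fun t => ‖φ.normed μ t‖ₑ with hρ
  have hρm : Measurable ρ := (φ.continuous_normed (μ := μ)).enorm.measurable
  set ν := μ.withDensity ρ with hν
  have hν1 : IsProbabilityMeasure ν := by
    constructor
    rw [hν, withDensity_apply _ MeasurableSet.univ, Measure.restrict_univ]
    have := ofReal_integral_eq_lintegral_ofReal (φ.integrable_normed (μ := μ))
      (Eventually.of_forall fun x => φ.nonneg_normed x)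
    rw [φ.integral_normed] at this
    simp only [hρ, Real.enorm_of_nonneg (φ.nonneg_normed (μ := μ) _)]
    rw [← this, ENNReal.ofReal_one]
  have hp0 : p ≠ 0 := (zero_lt_one.trans_le hp1).ne'
  have hpr : 0 < p.toReal := ENNReal.toReal_pos hp0 hp
  have hsub : ∀ x, StronglyMeasurable fun t => g (x - t) := fun x =>
    hg.comp_measurable (measurable_const.sub measurable_id)
  have key : ∀ x, ‖(φ.normed μ ⋆[ContinuousLinearMap.lsmul ℝ ℝ, μ] g) x‖ₑ ^ p.toReal
      ≤ ∫⁻ t, ‖g (x - t)‖ₑ ^ p.toReal ∂ν := by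
    intro x
    have h1 : ‖(φ.normed μ ⋆[ContinuousLinearMap.lsmul ℝ ℝ, μ] g) x‖ₑ ≤ ∫⁻ t, ‖g (x - t)‖ₑ ∂ν := by
      rw [convolution_def, hν, lintegral_withDensity_eq_lintegral_mul _ hρm (hsub x).enorm]
      refine (enorm_integral_le_lintegral_enorm _).trans (le_of_eq ?_)
      refine lintegral_congr fun t => ?_
      simp [hρ, enorm_smul]
    have h2 := eLpNorm_le_eLpNorm_of_exponent_le hp1 (μ := ν) (hsub x).aestronglyMeasurable
    rw [eLpNorm_one_eq_lintegral_enorm, eLpNorm_eq_lintegral_rpow_enorm_toReal hp0 hp] at h2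
    calc _ ≤ ((∫⁻ t, ‖g (x - t)‖ₑ ^ p.toReal ∂ν) ^ (1 / p.toReal)) ^ p.toReal :=
          ENNReal.rpow_le_rpow (h1.trans h2) hpr.le
      _ = _ := by rw [← ENNReal.rpow_mul, one_div, inv_mul_cancel₀ hpr.ne', ENNReal.rpow_one]
  rw [eLpNorm_eq_lintegral_rpow_enorm_toReal hp0 hp, eLpNorm_eq_lintegral_rpow_enorm_toReal hp0 hp]
  refine ENNReal.rpow_le_rpow ?_ (by positivity)
  calc _ ≤ ∫⁻ x, ∫⁻ t, ‖g (x - t)‖ₑ ^ p.toReal ∂ν ∂μ := lintegral_mono key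
    _ = ∫⁻ t, ∫⁻ x, ‖g (x - t)‖ₑ ^ p.toReal ∂μ ∂ν := by
        refine lintegral_lintegral_swap ?_
        have : Measurable fun z : E × E => ‖g (z.1 - z.2)‖ₑ :=
          (hg.comp_measurable (measurable_fst.sub measurable_snd)).enorm
        exact (this.pow_const _).aemeasurable
    _ = ∫⁻ _t, (∫⁻ x, ‖g x‖ₑ ^ p.toReal ∂μ) ∂ν := by
        refine lintegral_congr fun t => ?_
        exact lintegral_sub_right_eq_self (fun x => ‖g x‖ₑ ^ p.toReal) t
    _ = _ := by simp

variable [FiniteDimensional ℝ F]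

/-- Mollification of a compactly supported differentiable function with integrable derivative
commutes with differentiation. -/
theorem ContDiffBump.fderiv_normed_convolution (φ : ContDiffBump (0 : E)) {g : E → F}
    (hg : Differentiable ℝ g) (hg' : LocallyIntegrable (fderiv ℝ g) μ) :
    fderiv ℝ (φ.normed μ ⋆[ContinuousLinearMap.lsmul ℝ ℝ, μ] g)
      = (φ.normed μ ⋆[ContinuousLinearMap.lsmul ℝ ℝ, μ] fderiv ℝ g) := by
  ext x v
  have hφ : ContDiff ℝ 1 (φ.normed μ) := φ.contDiff_normed
  have hφc : HasCompactSupport (φ.normed μ) := φ.hasCompactSupport_normed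
  have hgl : LocallyIntegrable g μ := hg.continuous.locallyIntegrable
  rw [(hφc.hasFDerivAt_convolution_left (ContinuousLinearMap.lsmul ℝ ℝ) hφ hgl x).fderiv]
  have hA : ConvolutionExists (fderiv ℝ (φ.normed μ)) g
      ((ContinuousLinearMap.lsmul ℝ ℝ).precompL E) μ :=
    HasCompactSupport.convolutionExists_left _ (hφc.fderiv ℝ)
      (hφ.continuous_fderiv one_ne_zero) hgl
  have hB : ConvolutionExists (φ.normed μ) (fderiv ℝ g) (ContinuousLinearMap.lsmul ℝ ℝ) μ :=
    HasCompactSupport.convolutionExists_left _ hφc hφ.continuous hg'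
  have hC : ConvolutionExists (φ.normed μ) g (ContinuousLinearMap.lsmul ℝ ℝ) μ :=
    HasCompactSupport.convolutionExists_left _ hφc hφ.continuous hgl
  have hAi := (integrable_congr (Eventually.of_forall fun t => rfl)).1 (hA x)
  have hBi := (integrable_congr (Eventually.of_forall fun t => rfl)).1 (hB x)
  rw [convolution_def, convolution_def, ContinuousLinearMap.integral_apply (hA x),
    ContinuousLinearMap.integral_apply (hB x)]
  have hder : ∀ t, HasFDerivAt (fun t => g (x - t)) (-fderiv ℝ g (x - t)) t := fun t => by
    have h1 : HasFDerivAt (fun t : E => x - t) (-ContinuousLinearMap.id ℝ E) t := by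
      simpa using (hasFDerivAt_id t).const_sub x
    have := (hg (x - t)).hasFDerivAt.comp t h1
    rwa [ContinuousLinearMap.comp_neg, ContinuousLinearMap.comp_id] at this
  have := integral_smul_fderiv_eq_neg_fderiv_smul_of_integrable (μ := μ) (f := φ.normed μ)
    (g := fun t => g (x - t)) (v := v) ?_ ?_ ?_
    (fun t _ => (hφ.differentiable one_ne_zero) t) (fun t _ => (hder t).differentiableAt)
  · simp only [(hder _).fderiv, neg_apply, smul_neg, integral_neg, neg_inj]
      at this
    simpa [ContinuousLinearMap.precompL_apply] using this.symm
  · simpa [ContinuousLinearMap.precompL_apply] using hAi.apply_continuousLinearMap v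
  · simp only [(hder _).fderiv, neg_apply, smul_neg]
    exact (hBi.apply_continuousLinearMap v).neg
  · exact hC x

/-- A shrinking sequence of bump functions. -/
def shrinkingBump (E : Type*) [NormedAddCommGroup E] (k : ℕ) : ContDiffBump (0 : E) where
  rIn := 1 / ((k : ℝ) + 2)
  rOut := 1 / ((k : ℝ) + 1)
  rIn_pos := by positivity
  rIn_lt_rOut := by
    apply one_div_lt_one_div_of_lt <;> first | positivity | linarith

theorem tendsto_rOut_shrinkingBump (E : Type*) [NormedAddCommGroup E] :
    Tendsto (fun k => (shrinkingBump E k).rOut) atTop (𝓝 0) :=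
  tendsto_one_div_add_atTop_nhds_zero_nat

/-- Density of compactly supported `C¹` functions among compactly supported differentiable
functions with derivative in `L^p`. -/
theorem exists_contDiff_tendsto_eLpNorm_fderiv_sub {g : E → F} (hg : Differentiable ℝ g)
    (hgc : HasCompactSupport g) {p : ℝ≥0∞} (hp1 : 1 ≤ p) (hp : p ≠ ⊤)
    (hg' : MemLp (fderiv ℝ g) p μ) :
    ∃ G : ℕ → E → F, (∀ k, ContDiff ℝ 1 (G k) ∧ HasCompactSupport (G k)) ∧
      (∀ x, Tendsto (fun k => G k x) atTop (𝓝 (g x))) ∧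
      Tendsto (fun k => eLpNorm (fderiv ℝ (G k) - fderiv ℝ g) p μ) atTop (𝓝 0) := by
  borelize F
  set φ : ℕ → ContDiffBump (0 : E) := shrinkingBump E
  have hφ0 : Tendsto (fun k => (φ k).rOut) atTop (𝓝 0) :=
    tendsto_rOut_shrinkingBump E
  have hgl : LocallyIntegrable g μ := hg.continuous.locallyIntegrable
  have hloc : LocallyIntegrable (fderiv ℝ g) μ := hg'.locallyIntegrable hp1
  refine ⟨fun k => ((φ k).normed μ ⋆[ContinuousLinearMap.lsmul ℝ ℝ, μ] g), fun k => ⟨?_, ?_⟩,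
    fun x => ContDiffBump.convolution_tendsto_right_of_continuous hφ0 hg.continuous x, ?_⟩
  · exact (φ k).hasCompactSupport_normed.contDiff_convolution_left (n := 1) _
      (φ k).contDiff_normed hgl
  · exact (φ k).hasCompactSupport_normed.convolution _ hgc
  borelize (E →L[ℝ] F)
  set h := fderiv ℝ g
  have hsm : StronglyMeasurable h := (measurable_fderiv ℝ g).stronglyMeasurable
  simp_rw [(φ _).fderiv_normed_convolution hg hloc]
  rw [ENNReal.tendsto_atTop_zero]
  intro ε hε
  rcases eq_or_ne ε ⊤ with rfl | hε'
  · exact ⟨0, fun _ _ => le_top⟩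
  have hε3 : ε / 3 ≠ 0 := by simp [hε.ne']
  obtain ⟨c, hcc, hc1, hc2, hc3⟩ := hg'.exists_hasCompactSupport_eLpNorm_sub_le hp hε3
  set K := cthickening 1 (tsupport c)
  have hK : IsCompact K := hcc.isCompact.cthickening
  have hKm : μ K ≠ ⊤ := hK.measure_lt_top.ne
  have hp0 : p ≠ 0 := (zero_lt_one.trans_le hp1).ne'
  have hpr : 0 < p.toReal := ENNReal.toReal_pos hp0 hp
  obtain ⟨δ, hδ, hδε⟩ : ∃ δ : ℝ, 0 < δ ∧ (μ K) ^ p.toReal⁻¹ * ENNReal.ofReal δ ≤ ε / 3 := by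
    have : Tendsto (fun δ : ℝ => (μ K) ^ p.toReal⁻¹ * ENNReal.ofReal δ) (𝓝[>] 0) (𝓝 0) := by
      have h1 : Tendsto (fun δ : ℝ => ENNReal.ofReal δ) (𝓝[>] 0) (𝓝 0) := by
        have := (ENNReal.continuous_ofReal.tendsto 0).mono_left
          (nhdsWithin_le_nhds (s := Ioi (0 : ℝ)))
        simpa using this
      have h2 := ENNReal.Tendsto.const_mul (a := (μ K) ^ p.toReal⁻¹) h1
        (Or.inr (ENNReal.rpow_ne_top_of_nonneg (by positivity) hKm))
      simpa using h2
    have h2 := (this.eventually (ge_mem_nhds (pos_iff_ne_zero.2 hε3))).and self_mem_nhdsWithin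
    obtain ⟨δ, h3, h4⟩ := h2.exists
    exact ⟨δ, h4, h3⟩
  obtain ⟨η, hη, huc⟩ := Metric.uniformContinuous_iff.1
    (hcc.uniformContinuous_of_continuous hc2) δ hδ
  obtain ⟨N, hN⟩ := eventually_atTop.1 (hφ0.eventually (gt_mem_nhds (lt_min hη one_pos)))
  refine ⟨N, fun k hk => ?_⟩
  have hr := hN k hk
  set ψ := (φ k).normed μ
  have hcloc : LocallyIntegrable c μ := hc2.locallyIntegrable
  have hex : ∀ {q : E → E →L[ℝ] F}, LocallyIntegrable q μ →
      ConvolutionExists ψ q (ContinuousLinearMap.lsmul ℝ ℝ) μ := fun hq =>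
    HasCompactSupport.convolutionExists_left _ (φ k).hasCompactSupport_normed
      (φ k).continuous_normed hq
  have hsplit : (ψ ⋆[ContinuousLinearMap.lsmul ℝ ℝ, μ] h) - h =
      (ψ ⋆[ContinuousLinearMap.lsmul ℝ ℝ, μ] (h - c)) +
        (((ψ ⋆[ContinuousLinearMap.lsmul ℝ ℝ, μ] c) - c) + (c - h)) := by
    have : (ψ ⋆[ContinuousLinearMap.lsmul ℝ ℝ, μ] h) =
        (ψ ⋆[ContinuousLinearMap.lsmul ℝ ℝ, μ] (h - c)) +
          (ψ ⋆[ContinuousLinearMap.lsmul ℝ ℝ, μ] c) := by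
      rw [← ConvolutionExists.distrib_add (hex (hloc.sub hcloc)) (hex hcloc), sub_add_cancel]
    rw [this]
    abel
  have hcsm : StronglyMeasurable c := hc2.measurable.stronglyMeasurable
  have hm : ∀ {q : E → E →L[ℝ] F}, LocallyIntegrable q μ →
      Continuous (ψ ⋆[ContinuousLinearMap.lsmul ℝ ℝ, μ] q) := fun hq =>
    (φ k).hasCompactSupport_normed.continuous_convolution_left _ (φ k).continuous_normed hq
  have hmc : AEStronglyMeasurable ((ψ ⋆[ContinuousLinearMap.lsmul ℝ ℝ, μ] c) - c) μ :=
    ((hm hcloc).sub hc2).aestronglyMeasurable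
  have h1 : eLpNorm (ψ ⋆[ContinuousLinearMap.lsmul ℝ ℝ, μ] (h - c)) p μ ≤ ε / 3 :=
    ((φ k).eLpNorm_normed_convolution_le (hsm.sub hcsm) hp1 hp).trans hc1
  have h3 : eLpNorm (c - h) p μ ≤ ε / 3 := by rwa [eLpNorm_sub_comm]
  have hbound : ∀ x, ‖((ψ ⋆[ContinuousLinearMap.lsmul ℝ ℝ, μ] c) - c) x‖ ≤ δ := fun x => by
    rw [Pi.sub_apply, ← dist_eq_norm]
    refine (φ k).dist_normed_convolution_le hcsm.aestronglyMeasurable fun y hy => ?_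
    exact (huc ((mem_ball.1 hy).trans (hr.trans_le (min_le_left _ _)))).le
  have hzero : Function.support ((ψ ⋆[ContinuousLinearMap.lsmul ℝ ℝ, μ] c) - c) ⊆ K := by
    intro x hx
    by_contra hxK
    apply hx
    have hball : ∀ y ∈ ball x (φ k).rOut, c y = 0 := fun y hy => by
      by_contra hy0
      refine hxK (mem_cthickening_of_dist_le x y 1 _ (subset_tsupport c hy0) ?_)
      rw [dist_comm]
      exact ((mem_ball.1 hy).trans (hr.trans_le (min_le_right _ _))).le
    have hx0 : c x = 0 := hball x (mem_ball_self (φ k).rOut_pos)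
    have := (φ k).dist_normed_convolution_le (μ := μ) (ε := 0) (x₀ := x)
      hcsm.aestronglyMeasurable fun y hy => by rw [hball y hy, hx0, dist_self]
    rw [Pi.sub_apply, ← norm_eq_zero, ← dist_eq_norm]
    exact le_antisymm this dist_nonneg
  have h2 : eLpNorm ((ψ ⋆[ContinuousLinearMap.lsmul ℝ ℝ, μ] c) - c) p μ ≤ ε / 3 := by
    refine (eLpNorm_le_of_forall_notMem_eq_zero (s := K) (fun x hx => ?_) hbound).trans hδε
    exact Function.notMem_support.1 fun h => hx (hzero h)
  rw [hsplit]
  calc _ ≤ ε / 3 + (ε / 3 + ε / 3) := by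
        refine (eLpNorm_add_le (hm (hloc.sub hcloc)).aestronglyMeasurable
          (hmc.add (hcsm.sub hsm).aestronglyMeasurable) hp1).trans (add_le_add h1 ?_)
        exact (eLpNorm_add_le hmc (hcsm.sub hsm).aestronglyMeasurable hp1).trans
          (add_le_add h2 h3)
    _ = ε := by rw [← add_assoc, ENNReal.add_thirds]

end Mollification

section RowDet

variable {n : ℕ}

/-- The determinant of the linear map with the given coordinate functionals. -/
def rowDet (n : ℕ) : MultilinearMap ℝ (fun _ : Fin n => Vec n →L[ℝ] ℝ) ℝ :=
  (Matrix.detRowAlternating (n := Fin n) (R := ℝ)).toMultilinearMap.compLinearMap fun _ =>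
    { toFun := fun l k => l (EuclideanSpace.single k 1)
      map_add' := fun _ _ => rfl
      map_smul' := fun _ _ => rfl }

theorem rowDet_apply (l : Fin n → Vec n →L[ℝ] ℝ) :
    rowDet n l = (Matrix.of fun j k => l j (EuclideanSpace.single k 1)).det := rfl

theorem det_eq_rowDet (A : Vec n →L[ℝ] Vec n) :
    A.det = rowDet n fun j => (EuclideanSpace.proj j : Vec n →L[ℝ] ℝ) ∘L A := by
  rw [rowDet_apply, ContinuousLinearMap.det,
    ← LinearMap.det_toMatrix (EuclideanSpace.basisFun (Fin n) ℝ).toBasis]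
  congr 1

/-- Hadamard's inequality. -/
theorem abs_rowDet_le (l : Fin n → Vec n →L[ℝ] ℝ) : |rowDet n l| ≤ ∏ j, ‖l j‖ := by
  set v : Fin n → Vec n := fun j => WithLp.toLp 2 fun k => l j (EuclideanSpace.single k 1) with hv
  have hnorm : ∀ j, ‖v j‖ ≤ ‖l j‖ := by
    intro j
    have h1 : l j (v j) = ‖v j‖ ^ 2 := by
      have h2 : v j = ∑ k, v j k • EuclideanSpace.single k (1 : ℝ) := by
        ext i
        simp [Finset.sum_apply, Pi.single_apply]
      conv_lhs => rw [h2]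
      rw [map_sum, EuclideanSpace.norm_sq_eq]
      refine Finset.sum_congr rfl fun k _ => ?_
      rw [map_smul, smul_eq_mul, Real.norm_eq_abs, sq_abs, sq]
    have h3 := (l j).le_opNorm (v j)
    rw [h1, Real.norm_of_nonneg (by positivity)] at h3
    rcases (norm_nonneg (v j)).eq_or_lt with h | h
    · rw [← h]; positivity
    · nlinarith
  have : Fact (Module.finrank ℝ (Vec n) = n) := ⟨by simp⟩
  have h4 : |rowDet n l| = |(EuclideanSpace.basisFun (Fin n) ℝ).toBasis.det v| := by
    rw [rowDet_apply, Module.Basis.det_apply, ← Matrix.det_transpose]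
    congr 2
  rw [h4, ← Orientation.volumeForm_robust'
    ((EuclideanSpace.basisFun (Fin n) ℝ).toBasis.orientation)]
  exact (Orientation.abs_volumeForm_apply_le _ _).trans
    (Finset.prod_le_prod (fun _ _ => norm_nonneg _) fun j _ => hnorm j)

theorem norm_proj_comp_le (A : Vec n →L[ℝ] Vec n) (j : Fin n) :
    ‖(EuclideanSpace.proj j : Vec n →L[ℝ] ℝ) ∘L A‖ ≤ ‖A‖ :=
  ContinuousLinearMap.opNorm_le_bound _ (norm_nonneg _) fun x =>
    (PiLp.norm_apply_le (A x) j).trans (A.le_opNorm x)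

theorem abs_det_le_norm_pow (A : Vec n →L[ℝ] Vec n) : |A.det| ≤ ‖A‖ ^ n := by
  rw [det_eq_rowDet]
  refine (abs_rowDet_le _).trans ?_
  calc _ ≤ ∏ _j : Fin n, ‖A‖ :=
        Finset.prod_le_prod (fun _ _ => norm_nonneg _) fun j _ => norm_proj_comp_le A j
    _ = ‖A‖ ^ n := by simp

theorem abs_det_sub_det_le (A B : Vec n →L[ℝ] Vec n) :
    |A.det - B.det| ≤ n * (‖B‖ + ‖A - B‖) ^ (n - 1) * ‖A - B‖ := by
  rw [det_eq_rowDet, det_eq_rowDet]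
  have h := MultilinearMap.norm_image_sub_le_of_bound (rowDet n) zero_le_one
    (fun m => by rw [one_mul]; exact abs_rowDet_le m)
    (fun j => (EuclideanSpace.proj j : Vec n →L[ℝ] ℝ) ∘L A)
    (fun j => (EuclideanSpace.proj j : Vec n →L[ℝ] ℝ) ∘L B)
  rw [one_mul, Fintype.card_fin, Real.norm_eq_abs] at h
  refine h.trans ?_
  have hA : ‖A‖ ≤ ‖B‖ + ‖A - B‖ := by
    calc ‖A‖ = ‖B + (A - B)‖ := by rw [add_sub_cancel]
      _ ≤ _ := norm_add_le _ _
  gcongr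
  · refine max_le ((pi_norm_le_iff_of_nonneg (by positivity)).2 fun j => ?_)
      ((pi_norm_le_iff_of_nonneg (by positivity)).2 fun j => ?_)
    · exact (norm_proj_comp_le A j).trans hA
    · exact (norm_proj_comp_le B j).trans (by linarith [norm_nonneg (A - B)])
  · refine (pi_norm_le_iff_of_nonneg (by positivity)).2 fun j => ?_
    rw [Pi.sub_apply, ← ContinuousLinearMap.comp_sub]
    exact norm_proj_comp_le _ j

theorem abs_det_sub_det_le_add (hn : n ≠ 0) {ε : ℝ} (hε : 0 < ε) (hε1 : ε ≤ 1)
    (A B : Vec n →L[ℝ] Vec n) :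
    |A.det - B.det| ≤ ε * (n * 2 ^ (n - 1)) * ‖B‖ ^ n +
      n * (2 / ε) ^ (n - 1) * ‖A - B‖ ^ n := by
  obtain ⟨m, rfl⟩ := Nat.exists_eq_succ_of_ne_zero hn
  refine (abs_det_sub_det_le A B).trans ?_
  simp only [Nat.succ_eq_add_one, Nat.add_sub_cancel]
  set s := ‖A - B‖
  have hs : 0 ≤ s := norm_nonneg _
  set t := ‖B‖
  have ht : 0 ≤ t := norm_nonneg _
  rcases le_total s (ε * t) with h | h
  · have h1 : t + s ≤ 2 * t := by nlinarith
    calc (m + 1 : ℕ) * (t + s) ^ m * s ≤ (m + 1 : ℕ) * (2 * t) ^ m * (ε * t) := by gcongr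
      _ = ε * ((m + 1 : ℕ) * 2 ^ m) * t ^ (m + 1) := by ring
      _ ≤ _ := le_add_of_nonneg_right (by positivity)
  · have h1 : t + s ≤ 2 / ε * s := by
      have : t ≤ s / ε := by rw [le_div_iff₀ hε]; linarith
      have h2 : s ≤ s / ε := by rw [le_div_iff₀ hε]; nlinarith
      calc t + s ≤ s / ε + s / ε := by gcongr
        _ = _ := by ring
    calc (m + 1 : ℕ) * (t + s) ^ m * s ≤ (m + 1 : ℕ) * (2 / ε * s) ^ m * s := by gcongr
      _ = (m + 1 : ℕ) * (2 / ε) ^ m * s ^ (m + 1) := by ring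
      _ ≤ _ := le_add_of_nonneg_left (by positivity)

theorem integrable_det {A : Vec n → Vec n →L[ℝ] Vec n} (hn : n ≠ 0)
    {μ : Measure (Vec n)} (hA : MemLp A n μ) : Integrable (fun x => (A x).det) μ := by
  refine (hA.integrable_norm_pow hn).mono
    (ContinuousLinearMap.continuous_det.comp_aestronglyMeasurable hA.1)
    (Eventually.of_forall fun x => ?_)
  rw [Real.norm_eq_abs, Real.norm_of_nonneg (by positivity)]
  exact abs_det_le_norm_pow _

/-- The Jacobian determinant is a null Lagrangian on `W^{1,n}`. -/
theorem integral_det_fderiv_eq_zero (hn : n ≠ 0) {G : Vec n → Vec n} (hG : Differentiable ℝ G)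
    (hc : HasCompactSupport G) (hL : MemLp (fderiv ℝ G) n volume) :
    ∫ x, (fderiv ℝ G x).det = 0 := by
  have : NeZero n := ⟨hn⟩
  obtain ⟨Gk, h1, -, h2⟩ := exists_contDiff_tendsto_eLpNorm_fderiv_sub (μ := volume) hG hc
    (p := n) (by exact_mod_cast Nat.one_le_iff_ne_zero.2 hn) (by simp) hL
  have hnr : (0 : ℝ) < n := by positivity
  set T := ∫ x, ‖fderiv ℝ G x‖ ^ n
  have hkL : ∀ k, MemLp (fderiv ℝ (Gk k)) n volume := fun k =>
    ((h1 k).1.continuous_fderiv one_ne_zero).memLp_of_hasCompactSupport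
      ((h1 k).2.fderiv ℝ)
  have hS : Tendsto (fun k => ∫ x, ‖fderiv ℝ (Gk k) x - fderiv ℝ G x‖ ^ n) atTop (𝓝 0) := by
    have h3 : ∀ k, ∫ x, ‖fderiv ℝ (Gk k) x - fderiv ℝ G x‖ ^ n
        = (eLpNorm (fderiv ℝ (Gk k) - fderiv ℝ G) n volume).toReal ^ n := by
      intro k
      have h := ((hkL k).sub hL)
      rw [MemLp.eLpNorm_eq_integral_rpow_norm (by exact_mod_cast hn) (by simp) h,
        ENNReal.toReal_ofReal (by positivity)]
      simp only [ENNReal.toReal_natCast, Real.rpow_natCast]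
      rw [← Real.rpow_natCast, ← Real.rpow_mul (integral_nonneg fun _ => by positivity),
        inv_mul_cancel₀ hnr.ne', Real.rpow_one]
      rfl
    simp only [h3]
    have h4 := (((ENNReal.tendsto_toReal ENNReal.zero_ne_top).comp h2).pow n)
    simpa [hn] using h4
  have key : ∀ ε : ℝ, 0 < ε → ε ≤ 1 → |∫ x, (fderiv ℝ G x).det| ≤ ε * (n * 2 ^ (n - 1)) * T := by
    intro ε hε hε1
    have h5 : ∀ k, |∫ x, (fderiv ℝ G x).det| ≤ ε * (n * 2 ^ (n - 1)) * T
        + n * (2 / ε) ^ (n - 1) * ∫ x, ‖fderiv ℝ (Gk k) x - fderiv ℝ G x‖ ^ n := by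
      intro k
      have e : ∫ x, (fderiv ℝ G x).det
          = - ∫ x, ((fderiv ℝ (Gk k) x).det - (fderiv ℝ G x).det) := by
        rw [integral_sub (integrable_det hn (hkL k)) (integrable_det hn hL),
          integral_det_fderiv_eq_zero_of_contDiff volume (h1 k).1 (h1 k).2]
        ring
      rw [e, abs_neg, ← integral_const_mul, ← integral_const_mul, ← integral_add]
      · refine (abs_integral_le_integral_abs).trans (integral_mono_of_nonneg
          (Eventually.of_forall fun _ => abs_nonneg _) ?_ (Eventually.of_forall fun x =>
            abs_det_sub_det_le_add hn hε hε1 _ _))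
        exact ((hL.integrable_norm_pow hn).const_mul _).add
          ((((hkL k).sub hL).integrable_norm_pow hn).const_mul _)
      · exact (hL.integrable_norm_pow hn).const_mul _
      · exact (((hkL k).sub hL).integrable_norm_pow hn).const_mul _
    have h6 := (hS.const_mul (n * (2 / ε) ^ (n - 1))).const_add (ε * (n * 2 ^ (n - 1)) * T)
    rw [mul_zero, add_zero] at h6
    exact ge_of_tendsto' h6 h5
  have h7 : Tendsto (fun ε : ℝ => ε * (n * 2 ^ (n - 1)) * T) (𝓝[>] 0) (𝓝 0) := by
    have : Tendsto (fun ε : ℝ => ε * (n * 2 ^ (n - 1)) * T) (𝓝 0) (𝓝 (0 * (n * 2 ^ (n - 1)) * T)) :=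
      Continuous.tendsto (by fun_prop) 0
    simp only [zero_mul] at this
    exact this.mono_left nhdsWithin_le_nhds
  have h8 := ge_of_tendsto h7 (by
    filter_upwards [Ioc_mem_nhdsGT (zero_lt_one' ℝ)] with ε hε using key ε hε.1 hε.2)
  exact abs_eq_zero.1 (le_antisymm h8 (abs_nonneg _))

end RowDet

section Cutoff

/-- Smooth cutoff functions between concentric balls with the natural gradient bound. -/
theorem exists_cutoff : ∃ L : ℝ, 0 < L ∧ ∀ (n : ℕ) (y : Vec n) (r' r : ℝ), 0 < r' → r' < r →
    ∃ φ : Vec n → ℝ, ContDiff ℝ 1 φ ∧ (∀ x, 0 ≤ φ x) ∧ (∀ x, φ x ≤ 1) ∧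
      (∀ x ∈ closedBall y r', φ x = 1) ∧ tsupport φ ⊆ closedBall y r ∧
      ∀ x, ‖fderiv ℝ φ x‖ ≤ L / (r - r') := by
  have hcd : ContDiff ℝ 1 Real.smoothTransition := Real.smoothTransition.contDiff
  have hder : ∀ t, t ∉ Icc (0 : ℝ) 1 → deriv Real.smoothTransition t = 0 := by
    intro t ht
    rw [mem_Icc, not_and_or, not_le, not_le] at ht
    rcases ht with ht | ht
    · have : Real.smoothTransition =ᶠ[𝓝 t] fun _ => 0 := by
        filter_upwards [Iio_mem_nhds ht] with s hs using
          Real.smoothTransition.zero_of_nonpos (le_of_lt hs)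
      rw [this.deriv_eq, deriv_const]
    · have : Real.smoothTransition =ᶠ[𝓝 t] fun _ => 1 := by
        filter_upwards [Ioi_mem_nhds ht] with s hs using
          Real.smoothTransition.one_of_one_le (le_of_lt hs)
      rw [this.deriv_eq, deriv_const]
  obtain ⟨L, hL⟩ := isCompact_Icc.exists_bound_of_continuousOn
    ((hcd.continuous_deriv le_rfl).continuousOn (s := Icc (0 : ℝ) 1))
  have hL0 : 0 ≤ L := (norm_nonneg _).trans (hL 0 (by simp))
  have hbound : ∀ t, ‖deriv Real.smoothTransition t‖ ≤ L := fun t => by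
    by_cases ht : t ∈ Icc (0 : ℝ) 1
    · exact hL t ht
    · rw [hder t ht, norm_zero]; exact hL0
  refine ⟨2 * L + 1, by positivity, fun n y r' r hr' hr => ?_⟩
  have hd : 0 < r ^ 2 - r' ^ 2 := by nlinarith
  set q : Vec n → ℝ := fun x => (r ^ 2 - ‖x - y‖ ^ 2) / (r ^ 2 - r' ^ 2) with hq
  have hqc : ContDiff ℝ 1 q :=
    (contDiff_const.sub ((contDiff_id.sub contDiff_const).norm_sq ℝ)).div_const _
  have hsupp : tsupport (Real.smoothTransition ∘ q) ⊆ closedBall y r := by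
    refine closure_minimal (fun x hx => ?_) isClosed_closedBall
    by_contra h
    refine hx (Real.smoothTransition.zero_of_nonpos ?_)
    rw [mem_closedBall, dist_eq_norm, not_le] at h
    exact div_nonpos_of_nonpos_of_nonneg (by nlinarith) hd.le
  refine ⟨Real.smoothTransition ∘ q, hcd.comp hqc, fun x => Real.smoothTransition.nonneg _,
    fun x => Real.smoothTransition.le_one _, fun x hx => ?_, hsupp, fun x => ?_⟩
  · refine Real.smoothTransition.one_of_one_le ?_
    rw [mem_closedBall, dist_eq_norm] at hx
    rw [hq, one_le_div hd]
    nlinarith [norm_nonneg (x - y)]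
  · by_cases hx : x ∈ closedBall y r
    · rw [mem_closedBall, dist_eq_norm] at hx
      have h1 : HasFDerivAt q ((r ^ 2 - r' ^ 2)⁻¹ • -((2 : ℕ) • innerSL ℝ (x - y) : Vec n →L[ℝ] ℝ)) x := by
        have h2 : HasFDerivAt (fun x : Vec n => ‖x - y‖ ^ 2)
            ((2 : ℕ) • innerSL ℝ (x - y)) x := by
          simpa using ((hasFDerivAt_id x).sub_const y).norm_sq
        have h3 := (h2.const_sub (r ^ 2)).const_smul (r ^ 2 - r' ^ 2)⁻¹
        refine h3.congr_of_eventuallyEq (Eventually.of_forall fun z => ?_)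
        simp [hq, div_eq_inv_mul]
      have h4 : HasDerivAt Real.smoothTransition (deriv Real.smoothTransition (q x)) (q x) :=
        (hcd.differentiable one_ne_zero _).hasDerivAt
      rw [(h4.comp_hasFDerivAt x h1).fderiv, norm_smul, norm_smul, norm_neg]
      have h5 : ‖(2 : ℕ) • innerSL ℝ (x - y)‖ ≤ 2 * r := by
        refine (norm_nsmul_le).trans ?_
        rw [innerSL_apply_norm]
        push_cast
        linarith
      have h6 : ‖(r ^ 2 - r' ^ 2)⁻¹‖ = (r ^ 2 - r' ^ 2)⁻¹ := Real.norm_of_nonneg (by positivity)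
      rw [h6]
      calc _ ≤ L * ((r ^ 2 - r' ^ 2)⁻¹ * (2 * r)) := by gcongr; exact hbound _
        _ ≤ (2 * L) / (r - r') := by
          rw [← div_eq_inv_mul, ← mul_div_assoc, div_le_div_iff₀ hd (sub_pos.2 hr)]
          nlinarith [mul_nonneg hL0 (mul_nonneg (sub_pos.2 hr).le hr'.le)]
        _ ≤ _ := by
          have := sub_pos.2 hr
          gcongr
          linarith
    · have : x ∉ tsupport (fderiv ℝ (Real.smoothTransition ∘ q)) := fun h =>
        hx (hsupp (tsupport_fderiv_subset ℝ h))
      rw [image_eq_zero_of_notMem_tsupport this, norm_zero]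
      have := sub_pos.2 hr
      positivity

end Cutoff

section Caccioppoli

theorem hasDerivAt_max_zero_sq (t : ℝ) : HasDerivAt (fun t : ℝ => max t 0 ^ 2) (2 * max t 0) t := by
  rcases lt_trichotomy t 0 with h | rfl | h
  · rw [max_eq_right h.le, mul_zero]
    refine (hasDerivAt_const t (0 : ℝ)).congr_of_eventuallyEq ?_
    filter_upwards [Iio_mem_nhds h] with s hs
    rw [max_eq_right (le_of_lt hs)]
    ring
  · rw [max_self, mul_zero, hasDerivAt_iff_isLittleO]
    simp only [max_self, sub_zero, smul_eq_mul, mul_zero]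
    refine Asymptotics.IsBigO.trans_isLittleO (g := fun t : ℝ => t ^ 2) ?_ ?_
    · refine Asymptotics.IsBigO.of_bound 1 (Eventually.of_forall fun t => ?_)
      rw [one_mul, zero_pow two_ne_zero, sub_zero, norm_pow, norm_pow]
      refine pow_le_pow_left₀ (norm_nonneg _) ?_ 2
      rcases le_total t 0 with h | h <;> simp [h]
    · simpa using Asymptotics.isLittleO_pow_id (one_lt_two)
  · rw [max_eq_left h.le]
    have := hasDerivAt_pow 2 t
    simp only [Nat.cast_ofNat, Nat.add_one_sub_one, pow_one] at this
    refine this.congr_of_eventuallyEq ?_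
    filter_upwards [Ioi_mem_nhds h] with s hs
    rw [max_eq_left (le_of_lt hs)]

variable {n : ℕ}

/-- Multiplication by a `C¹` cutoff function. -/
theorem memLp_fderiv_mul_of_tsupport {χ g : Vec n → ℝ} (hχ : ContDiff ℝ 1 χ)
    (hc : HasCompactSupport χ) (hg : ∀ x ∈ tsupport χ, DifferentiableAt ℝ g x) {p : ℝ≥0∞}
    (hL : MemLp (fderiv ℝ g) p (volume.restrict (tsupport χ))) :
    Differentiable ℝ (fun x => χ x * g x) ∧ MemLp (fderiv ℝ fun x => χ x * g x) p volume := by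
  have hout : ∀ x ∉ tsupport χ, (fun x => χ x * g x) =ᶠ[𝓝 x] fun _ => 0 := fun x hx => by
    filter_upwards [notMem_tsupport_iff_eventuallyEq.1 hx] with z hz
    rw [hz]; simp
  have hχd := hχ.differentiable one_ne_zero
  refine ⟨fun x => ?_, ?_⟩
  · by_cases hx : x ∈ tsupport χ
    · exact (hχd x).mul (hg x hx)
    · exact (differentiableAt_const (0 : ℝ)).congr_of_eventuallyEq (hout x hx)
  have hgc : ContinuousOn g (tsupport χ) := fun x hx => (hg x hx).continuousAt.continuousWithinAt
  obtain ⟨A, hA⟩ := hc.isCompact.exists_bound_of_continuousOn hχ.continuous.continuousOn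
  obtain ⟨B, hB⟩ := hc.isCompact.exists_bound_of_continuousOn
    (hgc.norm.mul (hχ.continuous_fderiv one_ne_zero).norm.continuousOn)
  have hfin : IsFiniteMeasure (volume.restrict (tsupport χ)) :=
    ⟨by rw [Measure.restrict_apply_univ]; exact hc.isCompact.measure_lt_top⟩
  have h1 : MemLp (fun x => A * ‖fderiv ℝ g x‖ + B) p (volume.restrict (tsupport χ)) :=
    (hL.norm.const_mul A).add (memLp_const B)
  rw [← memLp_indicator_iff_restrict (isClosed_tsupport χ).measurableSet] at h1
  refine h1.mono (measurable_fderiv ℝ _).aestronglyMeasurable (Eventually.of_forall fun x => ?_)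
  by_cases hx : x ∈ tsupport χ
  · rw [indicator_of_mem hx, fderiv_fun_mul (hχd x) (hg x hx), Real.norm_eq_abs]
    refine le_trans ?_ (le_abs_self _)
    refine (norm_add_le _ _).trans ?_
    rw [norm_smul, norm_smul]
    have h2 := hB x hx
    rw [Pi.mul_apply, norm_mul, norm_norm, norm_norm] at h2
    gcongr
    exact hA x hx
  · rw [(hout x hx).fderiv_eq]
    simp

theorem norm_le_sum_norm_proj_comp {E : Type*} [NormedAddCommGroup E] [NormedSpace ℝ E]
    (A : E →L[ℝ] Vec n) :
    ‖A‖ ≤ ∑ j, ‖(EuclideanSpace.proj j : Vec n →L[ℝ] ℝ) ∘L A‖ := by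
  refine A.opNorm_le_bound (Finset.sum_nonneg fun _ _ => norm_nonneg _) fun v => ?_
  have h1 : A v = ∑ k, EuclideanSpace.single k (A v k) := by
    ext i
    simp [Finset.sum_apply, Pi.single_apply]
  rw [h1, Finset.sum_mul]
  refine (norm_sum_le _ _).trans (Finset.sum_le_sum fun j _ => ?_)
  rw [PiLp.norm_single]
  exact ((EuclideanSpace.proj j : Vec n →L[ℝ] ℝ) ∘L A).le_opNorm v

theorem pow_mul_le_young {m : ℕ} {a b δ : ℝ} (ha : 0 ≤ a) (hb : 0 ≤ b) (hδ : 0 < δ) :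
    a ^ m * b ≤ δ * a ^ (m + 1) + δ⁻¹ ^ m * b ^ (m + 1) := by
  rcases le_total b (δ * a) with h | h
  · calc a ^ m * b ≤ a ^ m * (δ * a) := by gcongr
      _ = δ * a ^ (m + 1) := by ring
      _ ≤ _ := le_add_of_nonneg_right (by positivity)
  · have : a ≤ δ⁻¹ * b := by rw [← div_eq_inv_mul, le_div_iff₀ hδ]; linarith
    calc a ^ m * b ≤ (δ⁻¹ * b) ^ m * b := by gcongr
      _ = δ⁻¹ ^ m * b ^ (m + 1) := by ring
      _ ≤ _ := le_add_of_nonneg_left (by positivity)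

theorem abs_rowDet_update_le (A : Vec n →L[ℝ] Vec n) (i : Fin n) (l : Vec n →L[ℝ] ℝ) :
    |rowDet n (Function.update (fun j => (EuclideanSpace.proj j : Vec n →L[ℝ] ℝ) ∘L A) i l)|
      ≤ ‖l‖ * ‖A‖ ^ (n - 1) := by
  refine (abs_rowDet_le _).trans ?_
  rw [← Finset.mul_prod_erase _ _ (Finset.mem_univ i), Function.update_self]
  gcongr
  calc _ ≤ ∏ _j ∈ Finset.univ.erase i, ‖A‖ := by
        refine Finset.prod_le_prod (fun _ _ => norm_nonneg _) fun j hj => ?_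
        rw [Function.update_of_ne (Finset.ne_of_mem_erase hj)]
        exact norm_proj_comp_le A j
    _ = _ := by simp [Finset.card_erase_of_mem]

theorem caccioppoli_pointwise {m : ℕ} {K φ w N D c M b : ℝ} (hK : 0 < K) (hφ : 0 ≤ φ) (hw : 0 ≤ w)
    (hN : 0 ≤ N) (hb : 0 ≤ b) (hD : N ^ (m + 1) ≤ K * D) (hM : |M| ≤ b * N ^ m)
    (hc : |c| ≤ (m + 1 : ℕ) * φ ^ m * w ^ 2) :
    w * φ ^ (m + 1) * N ^ (m + 1) ≤ K * (φ ^ (m + 1) * (2 * w) * D + c * M) +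
      (K * (m + 1 : ℕ)) ^ (m + 1) * (w ^ (m + 2) * b ^ (m + 1)) := by
  have hQ : 0 < K * (m + 1 : ℕ) := by positivity
  have h1 := pow_mul_le_young (m := m) (mul_nonneg hφ hN) (mul_nonneg hw hb) (inv_pos.2 hQ)
  rw [inv_inv] at h1
  set Q := K * (m + 1 : ℕ)
  have h2 : Q * w * ((φ * N) ^ m * (w * b)) ≤
      w * (φ * N) ^ (m + 1) + Q ^ (m + 1) * (w * (w * b) ^ (m + 1)) := by
    calc _ ≤ Q * w * (Q⁻¹ * (φ * N) ^ (m + 1) + Q ^ m * (w * b) ^ (m + 1)) := by gcongr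
      _ = _ := by field_simp; ring
  have h3 : K * |c * M| ≤ Q * w * ((φ * N) ^ m * (w * b)) := by
    rw [abs_mul]
    calc K * (|c| * |M|) ≤ K * (((m + 1 : ℕ) * φ ^ m * w ^ 2) * (b * N ^ m)) := by gcongr
      _ = _ := by simp only [Q]; ring
  have h4 : w * φ ^ (m + 1) * N ^ (m + 1) ≤ w * φ ^ (m + 1) * (K * D) := by gcongr
  have h5 := mul_le_mul_of_nonneg_left (neg_abs_le (c * M)) hK.le
  have h6 : w * (φ * N) ^ (m + 1) = w * φ ^ (m + 1) * N ^ (m + 1) := by ring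
  have h7 : w * (w * b) ^ (m + 1) = w ^ (m + 2) * b ^ (m + 1) := by ring
  rw [h6, h7] at h2
  nlinarith

/-- Caccioppoli's inequality for truncated coordinate functions of a quasiregular map. -/
theorem caccioppoli (hn : n ≠ 0) {K : ℝ} (hK : 0 < K) {f : Vec n → Vec n} {y : Vec n} {r R : ℝ}
    (hr : 0 < r) (hrR : r < R) (hd : ∀ x ∈ ball y R, DifferentiableAt ℝ f x)
    (hqr : ∀ᵐ x ∂(volume.restrict (ball y R)), ‖fderiv ℝ f x‖ ^ n ≤ K * (fderiv ℝ f x).det)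
    (hL : MemLp (fderiv ℝ f) n (volume.restrict (ball y R)))
    {φ : Vec n → ℝ} (hφ : ContDiff ℝ 1 φ) (hφ0 : ∀ x, 0 ≤ φ x) (hφs : tsupport φ ⊆ closedBall y r)
    (i : Fin n) {s : ℝ} (hs : s * s = 1) (k : ℝ) :
    ∫⁻ x, ENNReal.ofReal (max (s * f x i - k) 0 * φ x ^ n * ‖fderiv ℝ f x‖ ^ n) ≤
      ENNReal.ofReal ((K * n) ^ n) *
        ∫⁻ x, ENNReal.ofReal (max (s * f x i - k) 0 ^ (n + 1) * ‖fderiv ℝ φ x‖ ^ n) := by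
  obtain ⟨m, rfl⟩ := Nat.exists_eq_succ_of_ne_zero hn
  simp only [Nat.succ_eq_add_one] at *
  set w : Vec (m + 1) → ℝ := fun x => max (s * f x i - k) 0 with hw
  have hφc : HasCompactSupport φ := (isCompact_closedBall y r).of_isClosed_subset
    (isClosed_tsupport φ) hφs
  obtain ⟨L, -, hcut⟩ := exists_cutoff
  obtain ⟨χ, hχ, -, -, hχ1, hχs, -⟩ := hcut (m + 1) y ((2 * r + R) / 3) ((r + 2 * R) / 3)
    (by linarith) (by linarith)
  have hχc : HasCompactSupport χ := (isCompact_closedBall _ _).of_isClosed_subset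
    (isClosed_tsupport χ) hχs
  have hsub1 : tsupport φ ⊆ ball y R := hφs.trans (closedBall_subset_ball hrR)
  have hsub2 : tsupport χ ⊆ ball y R := hχs.trans (closedBall_subset_ball (by linarith))
  have hrow : ∀ x ∈ ball y R, ∀ j, HasFDerivAt (fun x => f x j)
      ((EuclideanSpace.proj j : Vec (m + 1) →L[ℝ] ℝ) ∘L fderiv ℝ f x) x := fun x hx j =>
    (EuclideanSpace.proj j : Vec (m + 1) →L[ℝ] ℝ).hasFDerivAt.comp x (hd x hx).hasFDerivAt
  have hw2 : ∀ x ∈ ball y R, HasFDerivAt (fun x => s * w x ^ 2)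
      ((2 * w x) • ((EuclideanSpace.proj i : Vec (m + 1) →L[ℝ] ℝ) ∘L fderiv ℝ f x)) x := by
    intro x hx
    have h1 := ((hasDerivAt_max_zero_sq (s * f x i - k)).comp_hasFDerivAt x
      (((hrow x hx i).const_mul s).sub_const k)).const_mul s
    refine h1.congr_fderiv ?_
    rw [smul_smul, smul_smul]
    congr 1
    simp only [hw]
    linear_combination (2 * max (s * f x i - k) 0) * hs
  have hfc : ContinuousOn f (ball y R) := fun x hx => (hd x hx).continuousAt.continuousWithinAt
  have hwc : ContinuousOn w (ball y R) := by
    refine ContinuousOn.sup ?_ continuousOn_const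
    exact (continuousOn_const.mul fun x hx => (hrow x hx i).continuousAt.continuousWithinAt).sub
      continuousOn_const
  have hφp : tsupport (fun x => φ x ^ (m + 1)) ⊆ tsupport φ :=
    closure_mono fun x hx h => hx (by simp [h])
  have hφpc : HasCompactSupport fun x => φ x ^ (m + 1) :=
    hφc.isCompact.of_isClosed_subset (isClosed_tsupport _) hφp
  set u : Fin (m + 1) → Vec (m + 1) → ℝ := fun j x =>
    if j = i then φ x ^ (m + 1) * (s * w x ^ 2) else χ x * f x j with hu
  have hu1 : ∀ j, Differentiable ℝ (u j) ∧ MemLp (fderiv ℝ (u j)) (m + 1 : ℕ) volume := by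
    intro j
    by_cases hj : j = i
    · have e : u j = fun x => φ x ^ (m + 1) * (s * w x ^ 2) := by simp [hu, hj]
      rw [e]
      refine memLp_fderiv_mul_of_tsupport (hφ.pow _) hφpc
        (fun x hx => (hw2 x (hsub1 (hφp hx))).differentiableAt) ?_
      obtain ⟨A, hA⟩ := hφpc.isCompact.exists_bound_of_continuousOn
        (hwc.mono (hφp.trans hsub1))
      refine (hL.mono_measure (Measure.restrict_mono (hφp.trans hsub1) le_rfl)).of_le_mul
        (c := 2 * A) (measurable_fderiv ℝ _).aestronglyMeasurable ?_
      filter_upwards [ae_restrict_mem (isClosed_tsupport _).measurableSet] with x hx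
      rw [(hw2 x (hsub1 (hφp hx))).fderiv, norm_smul, norm_mul, Real.norm_two]
      have := hA x hx
      exact mul_le_mul (by gcongr) (norm_proj_comp_le _ _) (norm_nonneg _)
        (mul_nonneg zero_le_two ((norm_nonneg _).trans this))
    · have e : u j = fun x => χ x * f x j := by simp [hu, hj]
      rw [e]
      refine memLp_fderiv_mul_of_tsupport hχ hχc
        (fun x hx => (hrow x (hsub2 hx) j).differentiableAt) ?_
      refine (hL.mono_measure (Measure.restrict_mono hsub2 le_rfl)).mono
        (measurable_fderiv ℝ _).aestronglyMeasurable ?_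
      filter_upwards [ae_restrict_mem (isClosed_tsupport _).measurableSet] with x hx
      rw [(hrow x (hsub2 hx) j).fderiv]
      exact norm_proj_comp_le _ _
  set G : Vec (m + 1) → Vec (m + 1) := fun x => WithLp.toLp 2 fun j => u j x with hG
  have hGd : Differentiable ℝ G := differentiable_euclidean.2 fun j => (hu1 j).1
  have hGrow : ∀ x j, (EuclideanSpace.proj j : Vec (m + 1) →L[ℝ] ℝ) ∘L fderiv ℝ G x =
      fderiv ℝ (u j) x := fun x j =>
    ((EuclideanSpace.proj j : Vec (m + 1) →L[ℝ] ℝ).hasFDerivAt.comp x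
      (hGd x).hasFDerivAt).fderiv.symm
  have hGL : MemLp (fderiv ℝ G) (m + 1 : ℕ) volume := by
    have h1 : MemLp (fun x => ∑ j, ‖fderiv ℝ (u j) x‖) (m + 1 : ℕ) volume :=
      memLp_finsetSum _ fun j _ => (hu1 j).2.norm
    refine h1.mono (measurable_fderiv ℝ _).aestronglyMeasurable (Eventually.of_forall fun x => ?_)
    refine (norm_le_sum_norm_proj_comp _).trans (le_trans (le_of_eq ?_) (le_abs_self _))
    simp only [hGrow]
  have hGc : HasCompactSupport G := by
    refine HasCompactSupport.intro (K := tsupport φ ∪ tsupport χ)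
      (hφc.isCompact.union hχc.isCompact) fun x hx => ?_
    rw [mem_union, not_or] at hx
    ext j
    simp [hG, hu, image_eq_zero_of_notMem_tsupport hx.1, image_eq_zero_of_notMem_tsupport hx.2]
  have hint := integral_det_fderiv_eq_zero hn hGd hGc hGL
  have hdet1 : ∀ x ∈ closedBall y r, (fderiv ℝ G x).det =
      φ x ^ (m + 1) * (2 * w x) * (fderiv ℝ f x).det +
        (s * w x ^ 2 * ((m + 1 : ℕ) * φ x ^ m)) * rowDet (m + 1) (Function.update (fun j =>
          (EuclideanSpace.proj j : Vec (m + 1) →L[ℝ] ℝ) ∘L fderiv ℝ f x) i (fderiv ℝ φ x)) := by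
    intro x hx
    have hxR : x ∈ ball y R := closedBall_subset_ball hrR hx
    have hrows : (fun j => (EuclideanSpace.proj j : Vec (m + 1) →L[ℝ] ℝ) ∘L fderiv ℝ G x) =
        Function.update (fun j => (EuclideanSpace.proj j : Vec (m + 1) →L[ℝ] ℝ) ∘L fderiv ℝ f x) i
          ((φ x ^ (m + 1) * (2 * w x)) •
            ((EuclideanSpace.proj i : Vec (m + 1) →L[ℝ] ℝ) ∘L fderiv ℝ f x) +
            (s * w x ^ 2 * ((m + 1 : ℕ) * φ x ^ m)) • fderiv ℝ φ x) := by
      funext j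
      rw [hGrow]
      by_cases hj : j = i
      · subst hj
        rw [Function.update_self]
        have e : u j = fun x => φ x ^ (m + 1) * (s * w x ^ 2) := by simp [hu]
        rw [e]
        have h1 := ((hφ.differentiable one_ne_zero x).hasFDerivAt.pow (m + 1)).mul (hw2 x hxR)
        refine h1.fderiv.trans ?_
        rw [smul_smul, smul_smul]
        congr 2
        rw [nsmul_eq_mul, Nat.add_sub_cancel]
      · rw [Function.update_of_ne hj]
        have e : u j =ᶠ[𝓝 x] fun x => f x j := by
          have : x ∈ ball y ((2 * r + R) / 3) := closedBall_subset_ball (by linarith) hx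
          filter_upwards [isOpen_ball.mem_nhds this] with z hz
          simp [hu, hj, hχ1 z (ball_subset_closedBall hz)]
        rw [e.fderiv_eq, (hrow x hxR j).fderiv]
    rw [det_eq_rowDet (fderiv ℝ G x), hrows, MultilinearMap.map_update_add,
      MultilinearMap.map_update_smul, MultilinearMap.map_update_smul, Function.update_eq_self,
      ← det_eq_rowDet, smul_eq_mul, smul_eq_mul]
  have hdet2 : ∀ x ∉ closedBall y r, (fderiv ℝ G x).det = 0 := by
    intro x hx
    rw [det_eq_rowDet]
    refine MultilinearMap.map_coord_zero _ i ?_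
    rw [hGrow]
    have e : u i =ᶠ[𝓝 x] fun _ => 0 := by
      filter_upwards [notMem_tsupport_iff_eventuallyEq.1 fun h => hx (hφs h)] with z hz
      simp [hu, hz]
    rw [e.fderiv_eq, fderiv_fun_const, Pi.zero_apply]
  have hDφ : ∀ x ∉ closedBall y r, fderiv ℝ φ x = 0 := fun x hx =>
    image_eq_zero_of_notMem_tsupport fun h => hx (hφs (tsupport_fderiv_subset ℝ h))
  have hpt : ∀ᵐ x, w x * φ x ^ (m + 1) * ‖fderiv ℝ f x‖ ^ (m + 1) ≤ K * (fderiv ℝ G x).det +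
      (K * (m + 1 : ℕ)) ^ (m + 1) * (w x ^ (m + 2) * ‖fderiv ℝ φ x‖ ^ (m + 1)) := by
    rw [ae_restrict_iff' measurableSet_ball] at hqr
    filter_upwards [hqr] with x hx
    by_cases hxr : x ∈ closedBall y r
    · rw [hdet1 x hxr]
      refine caccioppoli_pointwise hK (hφ0 x) (le_max_right _ _) (norm_nonneg _) (norm_nonneg _)
        (hx (closedBall_subset_ball hrR hxr)) (abs_rowDet_update_le _ _ _) ?_
      have hs1 : |s| = 1 := by
        rcases mul_self_eq_one_iff.1 hs with h | h <;> simp [h]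
      rw [abs_mul, abs_mul, hs1, abs_of_nonneg (by positivity),
        abs_of_nonneg (mul_nonneg (by positivity) (pow_nonneg (hφ0 x) _))]
      exact le_of_eq (by ring)
    · rw [hdet2 x hxr, hDφ x hxr,
        image_eq_zero_of_notMem_tsupport fun h => hxr (hφs h)]
      simp
  have hih : Integrable fun x => w x ^ (m + 2) * ‖fderiv ℝ φ x‖ ^ (m + 1) := by
    refine (integrableOn_iff_integrable_of_support_subset (s := closedBall y r) fun x hx => ?_).1 ?_
    · by_contra h
      exact hx (by simp [hDφ x h])
    · refine ContinuousOn.integrableOn_compact (isCompact_closedBall _ _) ?_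
      exact ((hwc.mono (closedBall_subset_ball hrR)).pow _).mul
        ((hφ.continuous_fderiv one_ne_zero).norm.pow _).continuousOn
  have hi1 := (integrable_det hn hGL).const_mul K
  have hi2 := hih.const_mul ((K * (m + 1 : ℕ)) ^ (m + 1))
  calc _ ≤ ∫⁻ x, ENNReal.ofReal (K * (fderiv ℝ G x).det +
      (K * (m + 1 : ℕ)) ^ (m + 1) * (w x ^ (m + 2) * ‖fderiv ℝ φ x‖ ^ (m + 1))) :=
        lintegral_mono_ae (hpt.mono fun x hx => ENNReal.ofReal_le_ofReal hx)
    _ = ENNReal.ofReal (∫ x, (K * (fderiv ℝ G x).det +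
      (K * (m + 1 : ℕ)) ^ (m + 1) * (w x ^ (m + 2) * ‖fderiv ℝ φ x‖ ^ (m + 1)))) := by
        refine (ofReal_integral_eq_lintegral_ofReal (hi1.add hi2) ?_).symm
        filter_upwards [hpt] with x hx
        exact (mul_nonneg (mul_nonneg (le_max_right _ _) (pow_nonneg (hφ0 x) _))
          (by positivity)).trans hx
    _ = _ := by
        rw [integral_add hi1 hi2, integral_const_mul, hint, mul_zero, zero_add, integral_const_mul,
          ENNReal.ofReal_mul (by positivity), ofReal_integral_eq_lintegral_ofReal hih]
        exact Eventually.of_forall fun x =>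
          mul_nonneg (pow_nonneg (le_max_right _ _) _) (by positivity)

end Caccioppoli

section Energy
variable {n : ℕ}

/-- The measure with density `‖Df‖ⁿ`. -/
def energyMeasure (f : Vec n → Vec n) : Measure (Vec n) :=
  volume.withDensity fun x => ‖fderiv ℝ f x‖ₑ ^ n

theorem energyMeasure_apply (f : Vec n → Vec n) {s : Set (Vec n)} (hs : MeasurableSet s) :
    energyMeasure f s = ∫⁻ x in s, ‖fderiv ℝ f x‖ₑ ^ n := withDensity_apply _ hs

theorem memLp_fderiv_of_energyMeasure (hn : n ≠ 0) {f : Vec n → Vec n} {s : Set (Vec n)}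
    (hs : MeasurableSet s) (h : energyMeasure f s < ⊤) :
    MemLp (fderiv ℝ f) n (volume.restrict s) := by
  refine ⟨(measurable_fderiv ℝ _).aestronglyMeasurable, ?_⟩
  rw [eLpNorm_lt_top_iff_lintegral_rpow_enorm_lt_top (by exact_mod_cast hn) (by simp)]
  simpa [energyMeasure_apply f hs] using h

theorem energyMeasure_closedBall_le (hn : n ≠ 0) {K : ℝ} (hK : 0 < K) :
    ∃ C : ℝ≥0∞, C ≠ ⊤ ∧ ∀ (f : Vec n → Vec n) (x : Vec n) (d M : ℝ), 0 < d → 0 < M →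
      (∀ z ∈ ball x d, DifferentiableAt ℝ f z) →
      (∀ᵐ z ∂(volume.restrict (ball x d)), ‖fderiv ℝ f z‖ ^ n ≤ K * (fderiv ℝ f z).det) →
      energyMeasure f (ball x d) < ⊤ → (∀ z ∈ ball x d, ‖f z - f x‖ ≤ M) →
      energyMeasure f (closedBall x (d / 2)) ≤ C * ENNReal.ofReal (M ^ n) := by
  obtain ⟨L, hL0, hcut⟩ := exists_cutoff
  refine ⟨ENNReal.ofReal ((K * n) ^ n) * (ENNReal.ofReal (3 ^ (n + 1) * (3 * L) ^ n) *
    volume (ball (0 : Vec n) 1)),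
    ENNReal.mul_ne_top ENNReal.ofReal_ne_top
      (ENNReal.mul_ne_top ENNReal.ofReal_ne_top measure_ball_lt_top.ne), ?_⟩
  intro f x d M hd hM hdiff hqr hfin hosc
  obtain ⟨φ, hφ, hφ0, hφ1, hφi, hφs, hφd⟩ := hcut n x (d / 2) (3 * d / 4) (by linarith)
    (by linarith)
  set i : Fin n := ⟨0, Nat.pos_of_ne_zero hn⟩
  have hcac := caccioppoli hn hK (by linarith) (by linarith : 3 * d / 4 < d) hdiff hqr
    (memLp_fderiv_of_energyMeasure hn measurableSet_ball hfin) hφ hφ0 hφs i (s := 1) (by norm_num)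
    (f x i - 2 * M)
  simp only [one_mul] at hcac
  set w : Vec n → ℝ := fun z => max (f z i - (f x i - 2 * M)) 0 with hw
  have hwb : ∀ z ∈ ball x d, M ≤ w z ∧ w z ≤ 3 * M := fun z hz => by
    have h1 : |f z i - f x i| ≤ M := (PiLp.norm_apply_le (f z - f x) i).trans (hosc z hz)
    rw [abs_le] at h1
    exact ⟨le_max_of_le_left (by linarith [h1.1]), max_le (by linarith [h1.2]) (by linarith)⟩
  have hleft : ENNReal.ofReal M * energyMeasure f (closedBall x (d / 2)) ≤
      ∫⁻ z, ENNReal.ofReal (w z * φ z ^ n * ‖fderiv ℝ f z‖ ^ n) := by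
    rw [energyMeasure_apply f measurableSet_closedBall,
      ← lintegral_const_mul' _ _ ENNReal.ofReal_ne_top]
    refine le_trans (setLIntegral_mono_ae' measurableSet_closedBall
      (Eventually.of_forall fun z hz => ?_)) (setLIntegral_le_lintegral (closedBall x (d / 2)) _)
    rw [hφi z hz, one_pow, mul_one, ENNReal.ofReal_mul (le_max_right _ _),
      ENNReal.ofReal_pow (norm_nonneg _), ofReal_norm]
    gcongr
    exact (hwb z (closedBall_subset_ball (by linarith) hz)).1
  have hright : ∫⁻ z, ENNReal.ofReal (w z ^ (n + 1) * ‖fderiv ℝ φ z‖ ^ n) ≤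
      ENNReal.ofReal ((3 * M) ^ (n + 1) * (L / (d / 4)) ^ n) *
        (ENNReal.ofReal ((3 * d / 4) ^ n) * volume (ball (0 : Vec n) 1)) := by
    have hvol : volume (closedBall x (3 * d / 4)) =
        ENNReal.ofReal ((3 * d / 4) ^ n) * volume (ball (0 : Vec n) 1) := by
      rw [Measure.addHaar_closedBall _ _ (by linarith), finrank_euclideanSpace_fin]
    rw [← hvol, ← setLIntegral_const, ← lintegral_indicator measurableSet_closedBall]
    refine lintegral_mono fun z => ?_
    by_cases hz : z ∈ closedBall x (3 * d / 4)
    · rw [indicator_of_mem hz]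
      apply ENNReal.ofReal_le_ofReal
      have h2 := hφd z
      rw [show 3 * d / 4 - d / 2 = d / 4 by ring] at h2
      have := hwb z (closedBall_subset_ball (by linarith) hz)
      have h3 : 0 ≤ w z := le_max_right _ _
      gcongr
      exact this.2
    · have : fderiv ℝ φ z = 0 :=
        image_eq_zero_of_notMem_tsupport fun h => hz (hφs (tsupport_fderiv_subset ℝ h))
      simp [this, hn]
  have hM0 : ENNReal.ofReal M ≠ 0 := by simpa using hM
  refine (ENNReal.mul_le_mul_iff_right hM0 ENNReal.ofReal_ne_top).1 ?_
  refine (hleft.trans (hcac.trans (mul_le_mul_right hright _))).trans (le_of_eq ?_)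
  rw [← mul_assoc (ENNReal.ofReal ((3 * M) ^ (n + 1) * (L / (d / 4)) ^ n)),
    ← ENNReal.ofReal_mul (by positivity)]
  have : (3 * M) ^ (n + 1) * (L / (d / 4)) ^ n * (3 * d / 4) ^ n =
      M * (M ^ n * (3 ^ (n + 1) * (3 * L) ^ n)) := by
    rw [mul_assoc, ← mul_pow]
    have : L / (d / 4) * (3 * d / 4) = 3 * L := by field_simp
    rw [this]
    ring
  rw [this, ENNReal.ofReal_mul hM.le, ENNReal.ofReal_mul (by positivity)]
  ring

theorem energyMeasure_diff_lt_top (hn : n ≠ 0) {K : ℝ} (hK : 0 < K) {f : Vec n → Vec n}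
    {U P : Set (Vec n)} {x₀ : Vec n} {ρ N : ℝ} (hρ : 0 < ρ) (hN : 0 < N) (hU : ball x₀ (4 * ρ) ⊆ U)
    (hρN : 4 * ρ * N ≤ 1)
    (hdiff : ∀ z ∈ U, DifferentiableAt ℝ f z)
    (hqr : ∀ᵐ z ∂(volume.restrict U), ‖fderiv ℝ f z‖ ^ n ≤ K * (fderiv ℝ f z).det)
    (hP : ∀ x ∈ U, x ∉ P ↔ (energyMeasure f).FiniteAtFilter (𝓝 x)) (hx₀ : x₀ ∈ P)
    (hlip : ∀ x ∈ P ∩ ball x₀ (4 * ρ), ∀ z ∈ U, ‖z - x‖ * N < 1 → ‖f z - f x‖ ≤ N * ‖z - x‖) :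
    energyMeasure f (ball x₀ ρ \ P) < ⊤ := by
  obtain ⟨C, hC, hen⟩ := energyMeasure_closedBall_le hn hK
  set W := ball x₀ ρ \ P with hW
  set d : Vec n → ℝ := fun x => infDist x P with hd
  have hPne : P.Nonempty := ⟨x₀, hx₀⟩
  have hd1 : ∀ x ∈ W, d x < ρ := fun x hx =>
    (infDist_le_dist_of_mem hx₀).trans_lt (mem_ball.1 hx.1)
  have hd0 : ∀ x ∈ W, 0 < d x := by
    intro x hx
    have hxU : x ∈ U := hU (ball_subset_ball (by linarith) hx.1)
    have h1 := (hP x hxU).1 hx.2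
    obtain ⟨s, hs, hs1⟩ := h1
    obtain ⟨ε, hε, hε1⟩ := Metric.nhds_basis_ball.mem_iff.1 hs
    have h2 : ∀ z ∈ ball x ε, (energyMeasure f).FiniteAtFilter (𝓝 z) := fun z hz =>
      ⟨ball x ε, isOpen_ball.mem_nhds hz, (measure_mono hε1).trans_lt hs1⟩
    have hx' : ball x₀ ρ ∈ 𝓝 x := isOpen_ball.mem_nhds hx.1
    obtain ⟨η, hη, hη1⟩ := Metric.nhds_basis_ball.mem_iff.1 hx'
    refine (lt_min hε hη).trans_le ((le_infDist hPne).2 fun {z} hz => ?_)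
    by_contra hlt
    rw [not_le, dist_comm, lt_min_iff] at hlt
    exact (hP z (hU (ball_subset_ball (by linarith) (hη1 hlt.2)))).2 (h2 z hlt.1) hz
  have hball : ∀ x ∈ W, ball x (d x) ⊆ ball x₀ (2 * ρ) := fun x hx z hz => by
    have h1 := mem_ball.1 hx.1
    have h2 := mem_ball.1 hz
    have := hd1 x hx
    rw [mem_ball]
    linarith [dist_triangle z x x₀]
  have hest : ∀ x ∈ W, energyMeasure f (closedBall x (d x / 4)) ≤
      C * ENNReal.ofReal ((5 * N * d x) ^ n) := by
    intro x hx
    have hdx := hd0 x hx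
    have hdx1 := hd1 x hx
    have hsub : ball x (d x / 2) ⊆ ball x₀ (2 * ρ) :=
      (ball_subset_ball (by linarith)).trans (hball x hx)
    have hsubU : ball x (d x / 2) ⊆ U := hsub.trans ((ball_subset_ball (by linarith)).trans hU)
    rw [show d x / 4 = (d x / 2) / 2 by ring]
    refine hen f x (d x / 2) (5 * N * d x) (by linarith) (by positivity)
      (fun z hz => hdiff z (hsubU hz)) (ae_mono (Measure.restrict_mono hsubU le_rfl) hqr) ?_ ?_
    · refine (measure_mono ball_subset_closedBall).trans_lt ?_
      refine (isCompact_closedBall x (d x / 2)).measure_lt_top_of_nhdsWithin fun z hz => ?_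
      have hz' : z ∈ ball x (d x) := closedBall_subset_ball (by linarith) hz
      have hzP : z ∉ P := fun h => by
        have := infDist_le_dist_of_mem (x := x) h
        rw [mem_ball, dist_comm] at hz'
        exact absurd this (not_le.2 hz')
      exact ((hP z (hU (ball_subset_ball (by linarith) (hball x hx hz')))).1 hzP).filter_mono
        nhdsWithin_le_nhds
    · intro z hz
      obtain ⟨q, hq, hq1⟩ := (infDist_lt_iff hPne).1 (show infDist x P < 2 * d x by
        change d x < _; linarith)
      have hz1 := mem_ball.1 hz
      have hx1 := mem_ball.1 hx.1
      have hqx : dist q x₀ < 4 * ρ := by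
        have := dist_triangle q x x₀
        rw [dist_comm q x] at this
        linarith
      have hzq : dist z q < 3 * d x := by linarith [dist_triangle z x q]
      have hxU : x ∈ U := hsubU (mem_ball_self (by linarith))
      have e1 := hlip q ⟨hq, hqx⟩ z (hsubU hz) (by
        rw [← dist_eq_norm]
        calc dist z q * N ≤ 3 * d x * N := by gcongr
          _ < 4 * ρ * N := by gcongr; linarith
          _ ≤ 1 := hρN)
      have e2 := hlip q ⟨hq, hqx⟩ x hxU (by
        rw [← dist_eq_norm]
        calc dist x q * N ≤ 2 * d x * N := by gcongr
          _ < 4 * ρ * N := by gcongr; linarith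
          _ ≤ 1 := hρN)
      rw [← dist_eq_norm, ← dist_eq_norm] at e1 e2
      rw [← dist_eq_norm]
      calc dist (f z) (f x) ≤ dist (f z) (f q) + dist (f x) (f q) := dist_triangle_right _ _ _
        _ ≤ N * (3 * d x) + N * (2 * d x) := by
          refine add_le_add (e1.trans ?_) (e2.trans ?_) <;> gcongr
        _ = _ := by ring
  obtain ⟨u, huW, hudisj, hucov⟩ := Vitali.exists_disjoint_subfamily_covering_enlargement_closedBall
    W (fun x => x) (fun x => d x / 20) ρ (fun x hx => by linarith [hd1 x hx, hd0 x hx]) 5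
    (by norm_num)
  have hucount : u.Countable := hudisj.countable_of_nonempty_interior fun x hx =>
    ⟨x, ball_subset_interior_closedBall (mem_ball_self (by linarith [hd0 x (huW hx)]))⟩
  have hcov : W ⊆ ⋃ x ∈ u, closedBall x (d x / 4) := fun x hx => by
    obtain ⟨b, hb, hsub⟩ := hucov x hx
    refine mem_iUnion₂.2 ⟨b, hb, ?_⟩
    have := hsub (mem_closedBall_self (by linarith [hd0 x hx]))
    rwa [show 5 * (d b / 20) = d b / 4 by ring] at this
  have hvol : ∀ x ∈ W, C * ENNReal.ofReal ((5 * N * d x) ^ n) *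
      volume (ball (0 : Vec n) 1) =
      C * ENNReal.ofReal ((100 * N) ^ n) * volume (closedBall x (d x / 20)) := fun x hx => by
    have e : (5 * N * d x) ^ n = (100 * N) ^ n * (d x / 20) ^ n := by
      rw [← mul_pow]
      congr 1
      ring
    rw [Measure.addHaar_closedBall _ _ (by linarith [hd0 x hx]), finrank_euclideanSpace_fin, e,
      ENNReal.ofReal_mul (by positivity)]
    ring
  have hv0 : volume (ball (0 : Vec n) 1) ≠ 0 := (measure_ball_pos _ _ one_pos).ne'
  have hvt : volume (ball (0 : Vec n) 1) ≠ ⊤ := measure_ball_lt_top.ne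
  have hmain : energyMeasure f W * volume (ball (0 : Vec n) 1) ≤
      C * ENNReal.ofReal ((100 * N) ^ n) * volume (ball x₀ (2 * ρ)) := by
    calc _ ≤ (∑' x : u, energyMeasure f (closedBall (x : Vec n) (d x / 4))) *
            volume (ball (0 : Vec n) 1) := by
          gcongr
          exact (measure_mono hcov).trans (measure_biUnion_le _ hucount _)
      _ = ∑' x : u, energyMeasure f (closedBall (x : Vec n) (d x / 4)) *
            volume (ball (0 : Vec n) 1) := ENNReal.tsum_mul_right.symm
      _ ≤ ∑' x : u, C * ENNReal.ofReal ((100 * N) ^ n) *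
            volume (closedBall (x : Vec n) (d x / 20)) := by
          refine ENNReal.tsum_le_tsum fun x => ?_
          rw [← hvol x (huW x.2)]
          gcongr
          exact hest x (huW x.2)
      _ = C * ENNReal.ofReal ((100 * N) ^ n) *
            volume (⋃ x ∈ u, closedBall (x : Vec n) (d x / 20)) := by
          rw [ENNReal.tsum_mul_left, measure_biUnion hucount hudisj
            fun _ _ => measurableSet_closedBall]
      _ ≤ _ := by
          gcongr
          refine iUnion₂_subset fun x hx => ?_
          exact (closedBall_subset_ball (by linarith [hd0 x (huW hx)])).trans (hball x (huW hx))
  by_contra htop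
  rw [not_lt, top_le_iff] at htop
  rw [htop, ENNReal.top_mul hv0, top_le_iff] at hmain
  exact ENNReal.mul_ne_top (ENNReal.mul_ne_top hC ENNReal.ofReal_ne_top)
    measure_ball_lt_top.ne hmain

/-- A differentiable map satisfying the quasiregular distortion inequality almost everywhere has
locally `n`-integrable derivative. -/
theorem energyMeasure_finiteAt (hn : n ≠ 0) {K : ℝ} (hK : 0 < K) {f : Vec n → Vec n}
    {U : Set (Vec n)} (hUo : IsOpen U) (hdiff : ∀ z ∈ U, DifferentiableAt ℝ f z)
    (hqr : ∀ᵐ z ∂(volume.restrict U), ‖fderiv ℝ f z‖ ^ n ≤ K * (fderiv ℝ f z).det) :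
    ∀ x ∈ U, (energyMeasure f).FiniteAtFilter (𝓝 x) := by
  by_contra! hbad
  set V := {x | (energyMeasure f).FiniteAtFilter (𝓝 x)} with hV
  have hVo : IsOpen V := isOpen_iff_mem_nhds.2 fun x ⟨s, hs, hs1⟩ => by
    filter_upwards [eventually_mem_nhds_iff.2 hs] with z hz using ⟨s, hz, hs1⟩
  set P := U \ V with hP
  have hPne : Nonempty P := by
    obtain ⟨x, hx, hx1⟩ := hbad
    exact ⟨x, hx, hx1⟩
  have hPl : IsLocallyClosed P := ⟨U, Vᶜ, hUo, hVo.isClosed_compl, rfl⟩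
  have : LocallyCompactSpace P := hPl.locallyCompactSpace
  set F : ℕ → Set P := fun k => {x | ∀ z ∈ U, ‖z - x‖ * (k + 1) < 1 →
    ‖f z - f x‖ ≤ (k + 1) * ‖z - x‖} with hF
  have hfP : Continuous fun x : P => f x := continuous_iff_continuousAt.2 fun x =>
    ContinuousAt.comp (hdiff x x.2.1).continuousAt continuous_subtype_val.continuousAt
  have hFc : ∀ k, IsClosed (F k) := by
    intro k
    simp only [hF, ofPred_forall]
    refine isClosed_iInter fun z => isClosed_iInter fun hz => ?_
    have : {x : P | ‖z - x‖ * (k + 1) < 1 → ‖f z - f x‖ ≤ (k + 1) * ‖z - x‖} =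
        {x : P | 1 ≤ ‖z - x‖ * (k + 1)} ∪ {x : P | ‖f z - f x‖ ≤ (k + 1) * ‖z - x‖} := by
      ext x
      exact ⟨fun h => (lt_or_ge _ _).elim (fun a => Or.inr (h a)) Or.inl,
        fun h a => h.elim (fun b => absurd a (not_lt.2 b)) id⟩
    have h2 := isClosed_le (f := fun _ : P => (1 : ℝ)) (g := fun x : P => ‖z - x‖ * (k + 1))
      (by fun_prop) (by fun_prop)
    have h3 := isClosed_le (f := fun x : P => ‖f z - f x‖) (g := fun x : P => (k + 1) * ‖z - x‖)
      (continuous_const.sub hfP).norm (by fun_prop)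
    have h4 := h2.union h3
    rwa [← this] at h4
  have hFu : ⋃ k, F k = univ := by
    refine eq_univ_of_forall fun x => ?_
    obtain ⟨c, hc⟩ := (hdiff x x.2.1).isBigO_sub.bound
    obtain ⟨ε, hε, hε1⟩ := Metric.eventually_nhds_iff.1 hc
    obtain ⟨k, hk⟩ := exists_nat_gt (max c (1 / ε))
    refine mem_iUnion.2 ⟨k, fun z _ hz1 => ?_⟩
    have hk1 : c < k := (le_max_left _ _).trans_lt hk
    have hk2 : 1 / ε < k := (le_max_right _ _).trans_lt hk
    rw [div_lt_iff₀ hε] at hk2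
    have h5 : ‖z - x‖ < ε := by
      by_contra h
      rw [not_lt] at h
      nlinarith [norm_nonneg (z - (x : Vec n)), (Nat.cast_nonneg k : (0 : ℝ) ≤ k)]
    refine (hε1 (by rwa [dist_eq_norm])).trans ?_
    gcongr
    linarith
  obtain ⟨k, ⟨x₀, P₁⟩, hx₀⟩ := nonempty_interior_of_iUnion_of_closed hFc hFu
  rw [mem_interior_iff_mem_nhds, nhds_subtype_eq_comap, mem_comap] at hx₀
  obtain ⟨t, ht, htF⟩ := hx₀
  obtain ⟨ε, hε, hε1⟩ := Metric.nhds_basis_ball.mem_iff.1 (inter_mem ht (hUo.mem_nhds P₁.1))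
  have hN : (0 : ℝ) < k + 1 := by positivity
  obtain ⟨ρ, hρdef⟩ : ∃ ρ : ℝ, ρ = min ε (1 / (k + 1)) / 4 := ⟨_, rfl⟩
  have hρ : 0 < ρ := by rw [hρdef]; positivity
  have hρε : 4 * ρ ≤ ε := by rw [hρdef]; linarith [min_le_left ε (1 / ((k : ℝ) + 1))]
  have hρN : 4 * ρ * (k + 1) ≤ 1 := by
    have : 4 * ρ ≤ 1 / (k + 1) := by rw [hρdef]; linarith [min_le_right ε (1 / ((k : ℝ) + 1))]
    rwa [le_div_iff₀ hN] at this
  have hballU : ball x₀ (4 * ρ) ⊆ U := fun z hz => (hε1 (ball_subset_ball hρε hz)).2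
  have hlip : ∀ x ∈ P ∩ ball x₀ (4 * ρ), ∀ z ∈ U, ‖z - x‖ * (k + 1 : ℝ) < 1 →
      ‖f z - f x‖ ≤ (k + 1 : ℝ) * ‖z - x‖ := by
    intro x hx
    have hxt : (⟨x, hx.1⟩ : P) ∈ Subtype.val ⁻¹' t :=
      mem_preimage.2 (hε1 (ball_subset_ball hρε hx.2)).1
    have hm : (⟨x, hx.1⟩ : P) ∈ F k := htF hxt
    exact hm
  have h1 := energyMeasure_diff_lt_top (P := P) hn hK hρ hN hballU hρN hdiff hqr
    (fun x hx => ⟨fun h => by_contra fun h' => h ⟨hx, h'⟩, fun h h' => h'.2 h⟩) P₁ hlip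
  have hPm : MeasurableSet P := hUo.measurableSet.diff hVo.measurableSet
  have h2 : energyMeasure f (P ∩ ball x₀ ρ) < ⊤ := by
    rw [energyMeasure_apply f (hPm.inter measurableSet_ball)]
    calc _ ≤ ∫⁻ _x in P ∩ ball x₀ ρ, ENNReal.ofReal (k + 1) ^ n := by
          refine setLIntegral_mono_ae' (hPm.inter measurableSet_ball)
            (Eventually.of_forall fun x hx => ?_)
          gcongr
          rw [← ofReal_norm]
          refine ENNReal.ofReal_le_ofReal ?_
          refine (hdiff x hx.1.1).hasFDerivAt.le_of_lip' hN.le ?_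
          have hx' : ball x (1 / (k + 1)) ∈ 𝓝 x := ball_mem_nhds _ (by positivity)
          filter_upwards [hx', hUo.mem_nhds hx.1.1] with z hz hzU
          refine hlip x ⟨hx.1, ball_subset_ball (by linarith) hx.2⟩ z hzU ?_
          rwa [mem_ball, dist_eq_norm, lt_div_iff₀ hN] at hz
      _ < ⊤ := by
          rw [setLIntegral_const]
          exact ENNReal.mul_lt_top (by simp)
            ((measure_mono inter_subset_right).trans_lt measure_ball_lt_top)
  refine P₁.2 ⟨ball x₀ ρ, ball_mem_nhds _ hρ, ?_⟩
  refine (measure_mono (t := (ball x₀ ρ \ P) ∪ (P ∩ ball x₀ ρ)) fun x hx => ?_).trans_lt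
    ((measure_union_le _ _).trans_lt (ENNReal.add_lt_top.2 ⟨h1, h2⟩))
  by_cases h : x ∈ P
  · exact Or.inr ⟨h, hx⟩
  · exact Or.inl ⟨hx, h⟩

theorem memLp_fderiv_of_isCompact (hn : n ≠ 0) {K : ℝ} (hK : 0 < K) {f : Vec n → Vec n}
    {U : Set (Vec n)} (hUo : IsOpen U) (hdiff : ∀ z ∈ U, DifferentiableAt ℝ f z)
    (hqr : ∀ᵐ z ∂(volume.restrict U), ‖fderiv ℝ f z‖ ^ n ≤ K * (fderiv ℝ f z).det)
    {S : Set (Vec n)} (hS : IsCompact S) (hSU : S ⊆ U) :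
    MemLp (fderiv ℝ f) n (volume.restrict S) :=
  memLp_fderiv_of_energyMeasure hn hS.isClosed.measurableSet <|
    hS.measure_lt_top_of_nhdsWithin fun x hx =>
      (energyMeasure_finiteAt hn hK hUo hdiff hqr x (hSU hx)).filter_mono nhdsWithin_le_nhds

end Energy

section DeGiorgi
variable {n : ℕ}

theorem eLpNorm_le_add_sub {α E : Type*} [MeasurableSpace α] {μ : Measure α}
    [NormedAddCommGroup E] {p : ℝ≥0∞} {g h : α → E} (hg : AEStronglyMeasurable g μ)
    (hh : AEStronglyMeasurable h μ) (hp : 1 ≤ p) :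
    eLpNorm h p μ ≤ eLpNorm g p μ + eLpNorm (h - g) p μ := by
  have := eLpNorm_add_le hg (hh.sub hg) hp
  rwa [add_sub_cancel] at this

/-- The Gagliardo–Nirenberg–Sobolev inequality for everywhere differentiable functions with
integrable derivative. -/
theorem lintegral_rpow_le_of_differentiable {q : ℝ} (hq : (n : ℝ).HolderConjugate q)
    {v : Vec n → ℝ} (hv : Differentiable ℝ v) (hc : HasCompactSupport v)
    (hL : MemLp (fderiv ℝ v) 1 volume) :
    ∫⁻ x, ‖v x‖ₑ ^ q ≤ lintegralPowLePowLIntegralFDerivConst (volume : Measure (Vec n)) q *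
      (∫⁻ x, ‖fderiv ℝ v x‖ₑ) ^ q := by
  obtain ⟨G, h1, h2, h3⟩ := exists_contDiff_tendsto_eLpNorm_fderiv_sub (μ := volume) hv hc
    le_rfl ENNReal.one_ne_top hL
  set C := lintegralPowLePowLIntegralFDerivConst (volume : Measure (Vec n)) q
  have hq0 : 0 < q := hq.symm.pos
  have hk : ∀ k, ∫⁻ x, ‖G k x‖ₑ ^ q ≤ C * ((∫⁻ x, ‖fderiv ℝ v x‖ₑ) +
      eLpNorm (fderiv ℝ (G k) - fderiv ℝ v) 1 volume) ^ q := by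
    intro k
    have := lintegral_pow_le_pow_lintegral_fderiv (volume : Measure (Vec n)) (h1 k).1 (h1 k).2
      (p := q) (by rwa [finrank_euclideanSpace_fin])
    refine this.trans ?_
    gcongr
    rw [← eLpNorm_one_eq_lintegral_enorm, ← eLpNorm_one_eq_lintegral_enorm]
    exact eLpNorm_le_add_sub hL.1
      (((h1 k).1.continuous_fderiv one_ne_zero).aestronglyMeasurable) le_rfl
  have hlim : Tendsto (fun k => C * ((∫⁻ x, ‖fderiv ℝ v x‖ₑ) +
      eLpNorm (fderiv ℝ (G k) - fderiv ℝ v) 1 volume) ^ q) atTop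
      (𝓝 (C * (∫⁻ x, ‖fderiv ℝ v x‖ₑ) ^ q)) := by
    have h4 := (h3.const_add (∫⁻ x, ‖fderiv ℝ v x‖ₑ)).ennrpow_const q
    rw [add_zero] at h4
    exact ENNReal.Tendsto.const_mul h4 (Or.inr ENNReal.coe_ne_top)
  calc ∫⁻ x, ‖v x‖ₑ ^ q = ∫⁻ x, liminf (fun k => ‖G k x‖ₑ ^ q) atTop := by
        refine lintegral_congr fun x => ?_
        exact (((h2 x).enorm).ennrpow_const q).liminf_eq.symm
    _ ≤ liminf (fun k => ∫⁻ x, ‖G k x‖ₑ ^ q) atTop :=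
        lintegral_liminf_le fun k => ((h1 k).1.continuous.enorm.measurable).pow_const q
    _ ≤ liminf (fun k => C * ((∫⁻ x, ‖fderiv ℝ v x‖ₑ) +
          eLpNorm (fderiv ℝ (G k) - fderiv ℝ v) 1 volume) ^ q) atTop :=
        liminf_le_liminf (Eventually.of_forall hk)
    _ = _ := hlim.liminf_eq

theorem truncation_gradient_pointwise {m : ℕ} {b w φ N c : ℝ} (hb : 0 < b) (hw : 0 ≤ w)
    (hw1 : w ≤ 1) (hφ : 0 ≤ φ) (hN : 0 ≤ N) (hcb : c ≤ b) :
    φ * (2 * w * N) + w ^ 2 * c ≤ 3 * b + 2 * b⁻¹ ^ m * (w * φ ^ (m + 1) * N ^ (m + 1)) := by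
  have h1 : φ * N ≤ b + b⁻¹ ^ m * (φ * N) ^ (m + 1) := by
    rcases le_total (φ * N) b with h | h
    · exact h.trans (le_add_of_nonneg_right (by positivity))
    · have h2 : 1 ≤ b⁻¹ * (φ * N) := by rw [← div_eq_inv_mul, one_le_div hb]; exact h
      calc φ * N ≤ (b⁻¹ * (φ * N)) ^ m * (φ * N) :=
            le_mul_of_one_le_left (by positivity) (one_le_pow₀ h2)
        _ = b⁻¹ ^ m * (φ * N) ^ (m + 1) := by ring
        _ ≤ _ := le_add_of_nonneg_left hb.le
  have h3 : w ^ 2 * c ≤ b := by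
    have : w ^ 2 ≤ 1 := pow_le_one₀ hw hw1
    nlinarith [sq_nonneg w]
  have h4 : w * (φ * N) ≤ w * (b + b⁻¹ ^ m * (φ * N) ^ (m + 1)) := by gcongr
  have h5 : w * b ≤ b := by nlinarith
  have h6 : w * (b⁻¹ ^ m * (φ * N) ^ (m + 1)) = b⁻¹ ^ m * (w * φ ^ (m + 1) * N ^ (m + 1)) := by
    ring
  nlinarith

theorem measurableSet_superlevel {f : Vec n → Vec n} {y : Vec n} {R r : ℝ} (hr : r < R)
    (hd : ∀ x ∈ ball y R, DifferentiableAt ℝ f x) (i : Fin n) (s k : ℝ) :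
    MeasurableSet {x ∈ closedBall y r | k < s * f x i} := by
  have hfc : ContinuousOn (fun x => s * f x i) (ball y R) := fun x hx =>
    (((EuclideanSpace.proj i : Vec n →L[ℝ] ℝ).continuous.continuousAt.comp
      (hd x hx).continuousAt).const_mul s).continuousWithinAt
  have h := (hfc.isOpen_inter_preimage isOpen_ball (isOpen_Ioi (a := k))).measurableSet.inter
    (measurableSet_closedBall (x := y) (ε := r))
  convert h using 1
  ext x
  constructor
  · exact fun hx => ⟨⟨closedBall_subset_ball hr hx.1, hx.2⟩, hx.1⟩
  · exact fun hx => ⟨hx.2, hx.1.2⟩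

/-- The gradient of the squared truncation is controlled by the measure of the superlevel set. -/
theorem lintegral_fderiv_truncation_le (hn : n ≠ 0) {K : ℝ} (hK : 0 < K) {f : Vec n → Vec n}
    {y : Vec n} {r R b : ℝ} (hr : 0 < r) (hrR : r < R) (hb : 0 < b)
    (hd : ∀ x ∈ ball y R, DifferentiableAt ℝ f x)
    (hqr : ∀ᵐ x ∂(volume.restrict (ball y R)), ‖fderiv ℝ f x‖ ^ n ≤ K * (fderiv ℝ f x).det)
    (hL : MemLp (fderiv ℝ f) n (volume.restrict (ball y R)))
    (hf1 : ∀ x ∈ ball y R, ‖f x‖ ≤ 1) (i : Fin n) {s : ℝ} (hs : s * s = 1) {k : ℝ} (hk : 0 ≤ k)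
    {φ : Vec n → ℝ} (hφ : ContDiff ℝ 1 φ) (hφ0 : ∀ x, 0 ≤ φ x)
    (hφs : tsupport φ ⊆ closedBall y r) (hφb : ∀ x, ‖fderiv ℝ φ x‖ ≤ b) :
    Differentiable ℝ (fun x => φ x * max (s * f x i - k) 0 ^ 2) ∧
    MemLp (fderiv ℝ fun x => φ x * max (s * f x i - k) 0 ^ 2) 1 volume ∧
    ∫⁻ x, ‖fderiv ℝ (fun x => φ x * max (s * f x i - k) 0 ^ 2) x‖ₑ ≤
      ENNReal.ofReal ((3 + 2 * (K * n) ^ n) * b) *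
        volume {x ∈ closedBall y r | k < s * f x i} := by
  obtain ⟨m, rfl⟩ := Nat.exists_eq_succ_of_ne_zero hn
  simp only [Nat.succ_eq_add_one] at *
  have hcac := caccioppoli hn hK hr hrR hd hqr hL hφ hφ0 hφs i hs k
  have hEm := measurableSet_superlevel hrR hd i s k
  set E := {x ∈ closedBall y r | k < s * f x i} with hE
  obtain ⟨w, hw⟩ : ∃ w : Vec (m + 1) → ℝ, w = fun x => max (s * f x i - k) 0 := ⟨_, rfl⟩
  have hww : ∀ x, max (s * f x i - k) 0 = w x := fun x => by rw [hw]
  simp only [hww] at hcac ⊢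
  have hs1 : |s| = 1 := by
    rcases mul_self_eq_one_iff.1 hs with h | h <;> simp [h]
  have hw0 : ∀ x, 0 ≤ w x := fun x => by rw [hw]; exact le_max_right _ _
  have hw1 : ∀ x ∈ ball y R, w x ≤ 1 := fun x hx => by
    rw [hw]
    refine max_le ?_ zero_le_one
    have h1 : |s * f x i| ≤ 1 := by
      rw [abs_mul, hs1, one_mul]
      exact (PiLp.norm_apply_le (f x) i).trans (hf1 x hx)
    linarith [le_abs_self (s * f x i)]
  have hwE : ∀ x ∈ closedBall y r, x ∉ E → w x = 0 := fun x hx hxE => by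
    rw [hw]
    refine max_eq_right ?_
    by_contra h
    exact hxE ⟨hx, by linarith⟩
  have hrow : ∀ x ∈ ball y R, HasFDerivAt (fun x => f x i)
      ((EuclideanSpace.proj i : Vec (m + 1) →L[ℝ] ℝ) ∘L fderiv ℝ f x) x := fun x hx =>
    (EuclideanSpace.proj i : Vec (m + 1) →L[ℝ] ℝ).hasFDerivAt.comp x (hd x hx).hasFDerivAt
  have hw2 : ∀ x ∈ ball y R, DifferentiableAt ℝ (fun x => w x ^ 2) x ∧
      ‖fderiv ℝ (fun x => w x ^ 2) x‖ ≤ 2 * w x * ‖fderiv ℝ f x‖ := by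
    intro x hx
    have h1 := (hasDerivAt_max_zero_sq (s * f x i - k)).comp_hasFDerivAt x
      (((hrow x hx).const_mul s).sub_const k)
    have h2 : HasFDerivAt (fun x => w x ^ 2) ((2 * max (s * f x i - k) 0) • s •
        ((EuclideanSpace.proj i : Vec (m + 1) →L[ℝ] ℝ) ∘L fderiv ℝ f x)) x := by
      rw [hw]; exact h1
    refine ⟨h2.differentiableAt, ?_⟩
    rw [h2.fderiv, norm_smul, norm_smul, Real.norm_eq_abs s, hs1, one_mul, norm_mul,
      Real.norm_two, hww, Real.norm_of_nonneg (hw0 x)]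
    have := hw0 x
    gcongr
    exact norm_proj_comp_le _ _
  have hsub : tsupport φ ⊆ ball y R := hφs.trans (closedBall_subset_ball hrR)
  have hφc : HasCompactSupport φ := (isCompact_closedBall y r).of_isClosed_subset
    (isClosed_tsupport φ) hφs
  have hfin : IsFiniteMeasure (volume.restrict (tsupport φ)) :=
    ⟨by rw [Measure.restrict_apply_univ]; exact hφc.isCompact.measure_lt_top⟩
  have hvL := memLp_fderiv_mul_of_tsupport (p := 1) (g := fun x => w x ^ 2) hφ hφc
    (fun x hx => (hw2 x (hsub hx)).1) (by
      have h3 : MemLp (fderiv ℝ f) 1 (volume.restrict (tsupport φ)) :=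
        (hL.mono_measure (Measure.restrict_mono hsub le_rfl)).mono_exponent
          (by exact_mod_cast Nat.le_add_left 1 m)
      refine h3.of_le_mul (c := 2) (measurable_fderiv ℝ _).aestronglyMeasurable ?_
      filter_upwards [ae_restrict_mem (isClosed_tsupport _).measurableSet] with x hx
      refine (hw2 x (hsub hx)).2.trans ?_
      gcongr
      linarith [hw1 x (hsub hx)])
  refine ⟨hvL.1, hvL.2, ?_⟩
  have hDφ : ∀ x ∉ closedBall y r, fderiv ℝ φ x = 0 := fun x hx =>
    image_eq_zero_of_notMem_tsupport fun h => hx (hφs (tsupport_fderiv_subset ℝ h))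
  have hpt : ∀ x, ‖fderiv ℝ (fun x => φ x * w x ^ 2) x‖ₑ ≤
      E.indicator (fun _ => ENNReal.ofReal (3 * b)) x + ENNReal.ofReal (2 * b⁻¹ ^ m) *
        ENNReal.ofReal (w x * φ x ^ (m + 1) * ‖fderiv ℝ f x‖ ^ (m + 1)) := by
    intro x
    by_cases hx : x ∈ closedBall y r
    · have hxR : x ∈ ball y R := closedBall_subset_ball hrR hx
      have h4 : ‖fderiv ℝ (fun x => φ x * w x ^ 2) x‖ ≤
          φ x * (2 * w x * ‖fderiv ℝ f x‖) + w x ^ 2 * ‖fderiv ℝ φ x‖ := by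
        rw [fderiv_fun_mul (hφ.differentiable one_ne_zero x) (hw2 x hxR).1]
        refine (norm_add_le _ _).trans ?_
        rw [norm_smul, norm_smul, Real.norm_of_nonneg (hφ0 x), Real.norm_of_nonneg (sq_nonneg _)]
        have := hφ0 x
        gcongr
        exact (hw2 x hxR).2
      rw [← ofReal_norm]
      by_cases hxE : x ∈ E
      · rw [indicator_of_mem hxE, ← ENNReal.ofReal_mul (by positivity),
          ← ENNReal.ofReal_add (by positivity)
            (mul_nonneg (by positivity) (mul_nonneg (mul_nonneg (hw0 x) (pow_nonneg (hφ0 x) _))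
              (by positivity)))]
        exact ENNReal.ofReal_le_ofReal (h4.trans (truncation_gradient_pointwise hb (hw0 x)
          (hw1 x hxR) (hφ0 x) (norm_nonneg _) (hφb x)))
      · rw [hwE x hx hxE] at h4
        have : ‖fderiv ℝ (fun x => φ x * w x ^ 2) x‖ = 0 :=
          le_antisymm (h4.trans (by simp)) (norm_nonneg _)
        rw [this, ENNReal.ofReal_zero]
        exact zero_le
    · have : (fun x => φ x * w x ^ 2) =ᶠ[𝓝 x] fun _ => 0 := by
        filter_upwards [notMem_tsupport_iff_eventuallyEq.1 fun h => hx (hφs h)] with z hz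
        rw [hz]; simp
      have h0 : ‖fderiv ℝ (fun x => φ x * w x ^ 2) x‖ = 0 := by
        rw [this.fderiv_eq, fderiv_fun_const]
        exact norm_zero
      rw [← ofReal_norm, h0, ENNReal.ofReal_zero]
      exact zero_le
  have hlast : ∫⁻ x, ENNReal.ofReal (w x ^ (m + 1 + 1) * ‖fderiv ℝ φ x‖ ^ (m + 1)) ≤
      ENNReal.ofReal (b ^ (m + 1)) * volume E := by
    rw [← setLIntegral_const, ← lintegral_indicator hEm]
    refine lintegral_mono fun x => ?_
    by_cases hx : x ∈ closedBall y r
    · by_cases hxE : x ∈ E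
      · rw [indicator_of_mem hxE]
        apply ENNReal.ofReal_le_ofReal
        calc _ ≤ 1 * b ^ (m + 1) := by
              have := hw0 x
              gcongr
              · exact pow_le_one₀ this (hw1 x (closedBall_subset_ball hrR hx))
              · exact hφb x
          _ = _ := one_mul _
      · simp [hwE x hx hxE]
    · simp [hDφ x hx]
  calc _ ≤ ∫⁻ x, (E.indicator (fun _ => ENNReal.ofReal (3 * b)) x + ENNReal.ofReal (2 * b⁻¹ ^ m) *
        ENNReal.ofReal (w x * φ x ^ (m + 1) * ‖fderiv ℝ f x‖ ^ (m + 1))) := lintegral_mono hpt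
    _ = ENNReal.ofReal (3 * b) * volume E + ENNReal.ofReal (2 * b⁻¹ ^ m) *
        ∫⁻ x, ENNReal.ofReal (w x * φ x ^ (m + 1) * ‖fderiv ℝ f x‖ ^ (m + 1)) := by
        rw [lintegral_add_left (measurable_const.indicator hEm), lintegral_indicator hEm,
          setLIntegral_const, lintegral_const_mul' _ _ ENNReal.ofReal_ne_top]
    _ ≤ ENNReal.ofReal (3 * b) * volume E + ENNReal.ofReal (2 * b⁻¹ ^ m) *
        (ENNReal.ofReal ((K * (m + 1 : ℕ)) ^ (m + 1)) *
          (ENNReal.ofReal (b ^ (m + 1)) * volume E)) := by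
        gcongr
        refine hcac.trans ?_
        gcongr
    _ = _ := by
        rw [← mul_assoc, ← mul_assoc, ← ENNReal.ofReal_mul (by positivity),
          ← ENNReal.ofReal_mul (by positivity), ← add_mul,
          ← ENNReal.ofReal_add (by positivity) (by positivity)]
        congr 2
        have h7 : b⁻¹ ^ m * b ^ (m + 1) = b := by
          rw [pow_succ, ← mul_assoc, ← mul_pow, inv_mul_cancel₀ hb.ne', one_pow, one_mul]
        linear_combination (2 * (K * (m + 1 : ℕ)) ^ (m + 1)) * h7

/-- The De Giorgi step: superlevel sets shrink super-linearly. -/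
theorem superlevel_step (hn : 2 ≤ n) {K : ℝ} (hK : 0 < K) :
    ∃ C : ℝ, 0 < C ∧ ∀ (f : Vec n → Vec n) (y : Vec n) (R : ℝ),
      (∀ x ∈ ball y R, DifferentiableAt ℝ f x) →
      (∀ᵐ x ∂(volume.restrict (ball y R)), ‖fderiv ℝ f x‖ ^ n ≤ K * (fderiv ℝ f x).det) →
      MemLp (fderiv ℝ f) n (volume.restrict (ball y R)) →
      (∀ x ∈ ball y R, ‖f x‖ ≤ 1) → ∀ (i : Fin n) (s : ℝ), s * s = 1 → ∀ r' r k k' : ℝ, 0 < r' →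
      r' < r → r < R → 0 ≤ k → k < k' →
      volume.real {x ∈ closedBall y r' | k' < s * f x i} ^ (n - 1) ≤
        (C * volume.real {x ∈ closedBall y r | k < s * f x i} / ((r - r') * (k' - k) ^ 2)) ^ n := by
  obtain ⟨L, hL0, hcut⟩ := exists_cutoff
  obtain ⟨m, rfl⟩ : ∃ m, n = m + 1 := ⟨n - 1, by omega⟩
  have hm : (m : ℝ) ≠ 0 := by
    have : m ≠ 0 := by omega
    exact_mod_cast this
  set q : ℝ := ((m + 1 : ℕ) : ℝ) / m with hq
  have hqm : q * m = (m + 1 : ℕ) := by rw [hq]; field_simp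
  have hconj : ((m + 1 : ℕ) : ℝ).HolderConjugate q := by
    rw [Real.holderConjugate_iff]
    refine ⟨by push_cast; linarith [(by positivity : (0 : ℝ) < m)], ?_⟩
    rw [hq]
    push_cast
    field_simp
    ring
  have hq0 : 0 < q := hconj.symm.pos
  set C₀ : ℝ≥0 := lintegralPowLePowLIntegralFDerivConst (volume : Measure (Vec (m + 1))) q
  set M : ℝ := 3 + 2 * (K * (m + 1 : ℕ)) ^ (m + 1) with hM
  have hM0 : 0 < M := by positivity
  refine ⟨(C₀ + 1) * M * L, by positivity, ?_⟩
  intro f y R hd hqr hL hf1 i s hs r' r k k' hr' hr hrR hk hkk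
  obtain ⟨φ, hφ, hφ0, hφ1, hφi, hφs, hφd⟩ := hcut (m + 1) y r' r hr' hr
  have hrr : 0 < r - r' := sub_pos.2 hr
  have hb : 0 < L / (r - r') := by positivity
  obtain ⟨hv1, hv2, hv3⟩ := lintegral_fderiv_truncation_le (by omega) hK (hr'.trans hr) hrR hb hd
    hqr hL hf1 i hs hk hφ hφ0 hφs hφd
  set v : Vec (m + 1) → ℝ := fun x => φ x * max (s * f x i - k) 0 ^ 2 with hv
  have hvc : HasCompactSupport v := by
    have hφc : HasCompactSupport φ := (isCompact_closedBall y r).of_isClosed_subset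
      (isClosed_tsupport φ) hφs
    exact hφc.mul_right
  have hgns := lintegral_rpow_le_of_differentiable hconj hv1 hvc hv2
  have hE'm := measurableSet_superlevel (hr.trans hrR) hd i s k'
  set E := {x ∈ closedBall y r | k < s * f x i} with hE
  set E' := {x ∈ closedBall y r' | k' < s * f x i} with hE'
  set c := (k' - k) ^ 2 with hc
  have hc0 : 0 < c := by have := sub_pos.2 hkk; positivity
  have hEt : volume E ≠ ⊤ :=
    ((measure_mono fun x hx => hx.1).trans_lt (isCompact_closedBall y r).measure_lt_top).ne
  have hcheb : ENNReal.ofReal c ^ q * volume E' ≤ ∫⁻ x, ‖v x‖ₑ ^ q := by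
    rw [← setLIntegral_const]
    refine le_trans (setLIntegral_mono_ae' hE'm (Eventually.of_forall fun x hx => ?_))
      (setLIntegral_le_lintegral E' _)
    gcongr
    rw [← ofReal_norm]
    apply ENNReal.ofReal_le_ofReal
    refine le_trans ?_ (le_abs_self _)
    rw [hv]
    dsimp only
    rw [hφi x hx.1, one_mul, hc]
    have h1 : k' < s * f x i := hx.2
    have := sub_pos.2 hkk
    gcongr
    exact le_max_of_le_left (by linarith)
  have h2 : ENNReal.ofReal c ^ q * volume E' ≤
      C₀ * (ENNReal.ofReal (M * (L / (r - r'))) * volume E) ^ q :=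
    hcheb.trans (hgns.trans (by gcongr))
  have h3 := ENNReal.rpow_le_rpow h2 (Nat.cast_nonneg m : (0 : ℝ) ≤ m)
  rw [ENNReal.mul_rpow_of_nonneg _ _ (Nat.cast_nonneg m),
    ENNReal.mul_rpow_of_nonneg _ _ (Nat.cast_nonneg m), ← ENNReal.rpow_mul, ← ENNReal.rpow_mul,
    hqm, ENNReal.rpow_natCast, ENNReal.rpow_natCast, ENNReal.rpow_natCast,
    ENNReal.rpow_natCast] at h3
  have h4 := ENNReal.toReal_mono (by finiteness) h3
  simp only [ENNReal.toReal_mul, ENNReal.toReal_pow, ENNReal.toReal_ofReal hc0.le,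
    ENNReal.coe_toReal, ENNReal.toReal_ofReal (by positivity : 0 ≤ M * (L / (r - r')))] at h4
  rw [Nat.add_sub_cancel]
  change (volume E').toReal ^ m ≤ ((C₀ + 1) * M * L * (volume E).toReal / ((r - r') * c)) ^ (m + 1)
  set e := (volume E).toReal
  have he : 0 ≤ e := ENNReal.toReal_nonneg
  have h5 : (C₀ : ℝ) ^ m ≤ (C₀ + 1) ^ (m + 1) := by
    calc (C₀ : ℝ) ^ m ≤ (C₀ + 1) ^ m := by gcongr; linarith
      _ ≤ _ := pow_le_pow_right₀ (by linarith [C₀.coe_nonneg]) (Nat.le_succ m)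
  rw [← mul_le_mul_iff_right₀ (pow_pos hc0 (m + 1))]
  refine h4.trans ?_
  calc _ ≤ ((C₀ : ℝ) + 1) ^ (m + 1) * (M * (L / (r - r')) * e) ^ (m + 1) := by gcongr
    _ = _ := by
      rw [← mul_pow, ← mul_pow]
      congr 1
      field_simp

end DeGiorgi

section Iteration
variable {n : ℕ}

/-- Fast geometric convergence of super-linear recursions. -/
theorem le_geometric_of_superlinear {m : ℕ} (hm : m ≠ 0) {D l : ℝ} (hD : 0 < D)
    (hl : l * 8 ^ (m + 1) = 1) {a : ℕ → ℝ} (ha : ∀ j, 0 ≤ a j)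
    (hstep : ∀ j, a (j + 1) ^ m ≤ (D * 8 ^ j * a j) ^ (m + 1))
    (h0 : a 0 ≤ l ^ m / D ^ (m + 1)) (j : ℕ) : a j ≤ l ^ m / D ^ (m + 1) * l ^ j := by
  have hl0 : 0 < l := by
    by_contra h
    have : l * 8 ^ (m + 1) ≤ 0 := mul_nonpos_of_nonpos_of_nonneg (not_lt.1 h) (by positivity)
    linarith
  induction j with
  | zero => simpa using h0
  | succ j ih =>
    refine le_of_pow_le_pow_left₀ hm (by positivity) ?_
    obtain ⟨v, hv⟩ : ∃ v, v = l ^ m / D ^ (m + 1) := ⟨_, rfl⟩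
    rw [← hv] at ih ⊢
    have hDv : D ^ (m + 1) * v = l ^ m := by rw [hv]; field_simp
    have h8 : (8 : ℝ) ^ ((m + 1) * j) * l ^ j = 1 := by
      rw [pow_mul, ← mul_pow, mul_comm, hl, one_pow]
    calc a (j + 1) ^ m ≤ (D * 8 ^ j * a j) ^ (m + 1) := hstep j
      _ ≤ (D * 8 ^ j * (v * l ^ j)) ^ (m + 1) := by
        have := ha j
        gcongr
      _ = (D ^ (m + 1) * v) * (8 ^ ((m + 1) * j) * l ^ j) * (v ^ m * l ^ (j * m)) := by
        rw [mul_pow, mul_pow, mul_pow, ← pow_mul, ← pow_mul]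
        ring
      _ = (v * l ^ (j + 1)) ^ m := by
        rw [hDv, h8, mul_pow, ← pow_mul, add_mul, pow_add, one_mul]
        ring

/-- De Giorgi's lemma for coordinates of quasiregular maps. -/
theorem le_of_superlevel_small (hn : 2 ≤ n) {K : ℝ} (hK : 0 < K) {θ : ℝ} (hθ : 0 < θ) :
    ∃ ν : ℝ, 0 < ν ∧ ∀ (f : Vec n → Vec n) (y : Vec n) (R : ℝ),
      (∀ x ∈ ball y R, DifferentiableAt ℝ f x) →
      (∀ᵐ x ∂(volume.restrict (ball y R)), ‖fderiv ℝ f x‖ ^ n ≤ K * (fderiv ℝ f x).det) →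
      MemLp (fderiv ℝ f) n (volume.restrict (ball y R)) →
      (∀ x ∈ ball y R, ‖f x‖ ≤ 1) → ∀ (i : Fin n) (s : ℝ), s * s = 1 → ∀ ρ : ℝ, 0 < ρ → ρ < R →
      volume.real {x ∈ closedBall y ρ | θ / 2 < s * f x i} ≤ ν * ρ ^ n → s * f y i ≤ θ := by
  obtain ⟨C, hC, hstep⟩ := superlevel_step hn hK
  obtain ⟨m, rfl⟩ : ∃ m, n = m + 1 := ⟨n - 1, by omega⟩
  have hm : m ≠ 0 := by omega
  obtain ⟨l, hl⟩ : ∃ l : ℝ, l = (8 ^ (m + 1))⁻¹ := ⟨_, rfl⟩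
  have hl0 : 0 < l := by rw [hl]; positivity
  have hl1 : l < 1 := by
    rw [hl]; exact inv_lt_one_of_one_lt₀ (one_lt_pow₀ (by norm_num) (by omega))
  refine ⟨l ^ m * (θ ^ 2 / (64 * C)) ^ (m + 1), by positivity, ?_⟩
  intro f y R hd hqr hL hf1 i s hs ρ hρ hρR hsmall
  obtain ⟨a, ha⟩ : ∃ a : ℕ → ℝ, a = fun j => volume.real
      {x ∈ closedBall y (ρ * (1 / 2 + (1 / 2) ^ (j + 1))) |
        θ * (1 - (1 / 2) ^ (j + 1)) < s * f x i} := ⟨_, rfl⟩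
  have hrj : ∀ j : ℕ, ρ * (1 / 2 + (1 / 2) ^ (j + 1)) ≤ ρ := fun j => by
    have : (1 / 2 : ℝ) ^ (j + 1) ≤ (1 / 2) ^ 1 :=
      pow_le_pow_of_le_one (by norm_num) (by norm_num) (by omega)
    nlinarith
  have hgeo := le_geometric_of_superlinear (m := m) hm (D := 64 * C / (ρ * θ ^ 2)) (l := l)
    (by positivity) (by rw [hl]; exact inv_mul_cancel₀ (by positivity)) (a := a)
    (fun j => by rw [ha]; exact measureReal_nonneg) (fun j => by
      have hj : 0 < (1 / 2 : ℝ) ^ (j + 1) := by positivity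
      have hj1 : (1 / 2 : ℝ) ^ (j + 1) ≤ 1 := pow_le_one₀ (by norm_num) (by norm_num)
      have h1 := hstep f y R hd hqr hL hf1 i s hs (ρ * (1 / 2 + (1 / 2) ^ (j + 1 + 1)))
        (ρ * (1 / 2 + (1 / 2) ^ (j + 1))) (θ * (1 - (1 / 2) ^ (j + 1)))
        (θ * (1 - (1 / 2) ^ (j + 1 + 1))) (by positivity)
        (by rw [pow_succ _ (j + 1)]; gcongr; linarith) ((hrj j).trans_lt hρR)
        (mul_nonneg hθ.le (by linarith)) (by rw [pow_succ _ (j + 1)]; gcongr; linarith)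
      rw [Nat.add_sub_cancel] at h1
      rw [ha]
      refine h1.trans (le_of_eq ?_)
      congr 1
      have h2 : (ρ * (1 / 2 + (1 / 2) ^ (j + 1)) - ρ * (1 / 2 + (1 / 2) ^ (j + 1 + 1))) *
          (θ * (1 - (1 / 2) ^ (j + 1 + 1)) - θ * (1 - (1 / 2) ^ (j + 1))) ^ 2 =
          ρ * θ ^ 2 / (64 * 8 ^ j) := by
        have : (8 : ℝ) ^ j = (2 ^ j) ^ 3 := by rw [← pow_mul, mul_comm, pow_mul]; norm_num
        rw [this, pow_succ (1 / 2 : ℝ) (j + 1), pow_succ (1 / 2 : ℝ) j, one_div_pow]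
        field_simp
        ring
      rw [h2]
      field_simp)
    (by
      refine le_trans (le_of_eq ?_) (hsmall.trans (le_of_eq ?_))
      · rw [ha]
        norm_num
        congr 1
        ext x
        simp only [mem_ofPred_eq]
        rw [div_eq_mul_one_div θ 2]
      · rw [div_pow, div_pow, mul_pow ρ]
        field_simp)
  by_contra hcon
  rw [not_le] at hcon
  have hf : ContinuousAt (fun x => s * f x i) y :=
    ((EuclideanSpace.proj i : Vec (m + 1) →L[ℝ] ℝ).continuous.continuousAt.comp
      (hd y (mem_ball_self (hρ.trans hρR))).continuousAt).const_mul s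
  have hpos : 0 < volume.real {x ∈ closedBall y (ρ / 2) | θ < s * f x i} := by
    refine ENNReal.toReal_pos (Measure.measure_pos_of_mem_nhds volume (x := y) ?_).ne'
      ((measure_mono fun x hx => hx.1).trans_lt
        (isCompact_closedBall y (ρ / 2)).measure_lt_top).ne
    exact inter_mem (closedBall_mem_nhds y (by positivity)) (hf (Ioi_mem_nhds hcon))
  have hle : ∀ j, volume.real {x ∈ closedBall y (ρ / 2) | θ < s * f x i} ≤
      l ^ m / (64 * C / (ρ * θ ^ 2)) ^ (m + 1) * l ^ j := fun j => by
    refine le_trans ?_ (hgeo j)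
    have hj : 0 < (1 / 2 : ℝ) ^ (j + 1) := by positivity
    rw [ha]
    refine measureReal_mono (fun x hx => ⟨closedBall_subset_closedBall (by nlinarith) hx.1, ?_⟩)
      ((measure_mono fun x hx => hx.1).trans_lt (isCompact_closedBall y _).measure_lt_top).ne
    have h3 : θ < s * f x i := hx.2
    nlinarith
  have hlim := (tendsto_pow_atTop_nhds_zero_of_lt_one hl0.le hl1).const_mul
    (l ^ m / (64 * C / (ρ * θ ^ 2)) ^ (m + 1))
  rw [mul_zero] at hlim
  exact absurd (ge_of_tendsto' hlim hle) (not_le.2 hpos)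

end Iteration

section MeanValue
variable {n : ℕ}

theorem exists_norm_le_mul_abs_apply (hn : n ≠ 0) (v : Vec n) : ∃ i, ‖v‖ ≤ n * |v i| := by
  by_contra! h
  have h1 : ‖v‖ ≤ ∑ i, |v i| := by
    refine (EuclideanSpace.norm_eq v).le.trans ?_
    rw [Real.sqrt_le_left (Finset.sum_nonneg fun i _ => abs_nonneg _)]
    exact Finset.sum_sq_le_sq_sum_of_nonneg fun i _ => abs_nonneg _
  have : NeZero n := ⟨hn⟩
  have h2 : ∑ i, n * |v i| < ∑ _i : Fin n, ‖v‖ :=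
    Finset.sum_lt_sum_of_nonempty Finset.univ_nonempty fun i _ => h i
  rw [← Finset.mul_sum, Finset.sum_const, Finset.card_univ, Fintype.card_fin, nsmul_eq_mul] at h2
  have : (0 : ℝ) < n := by positivity
  nlinarith

theorem rpow_norm_mul_pow_le_of_bounded (hn : 2 ≤ n) {K A p : ℝ} (hK : 0 < K) (hA : 0 < A)
    (hp : 0 < p) :
    ∃ C : ℝ, 0 < C ∧ ∀ (f : Vec n → Vec n) (y : Vec n) (R : ℝ), 0 < R →
      (∀ x ∈ ball y R, DifferentiableAt ℝ f x) →
      (∀ᵐ x ∂(volume.restrict (ball y R)), ‖fderiv ℝ f x‖ ^ n ≤ K * (fderiv ℝ f x).det) →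
      MemLp (fderiv ℝ f) n (volume.restrict (ball y R)) → f y ≠ 0 →
      (∀ x ∈ ball y R, ‖f x‖ ≤ A * ‖f y‖) →
      ENNReal.ofReal (‖f y‖ ^ p * R ^ n) ≤
        ENNReal.ofReal C * ∫⁻ z in ball y R, ENNReal.ofReal (‖f z‖ ^ p) := by
  have hn0 : (0 : ℝ) < n := by
    have : 0 < n := by omega
    exact_mod_cast this
  obtain ⟨θ, hθ⟩ : ∃ θ : ℝ, θ = 1 / (2 * n * A) := ⟨_, rfl⟩
  have hθ0 : 0 < θ := by rw [hθ]; positivity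
  obtain ⟨ν, hν, hdg⟩ := le_of_superlevel_small hn hK hθ0
  refine ⟨(4 * n) ^ p * 2 ^ n / ν, by positivity, ?_⟩
  intro f y R hR hd hqr hL hy hb
  have hy0 : 0 < ‖f y‖ := norm_pos_iff.2 hy
  obtain ⟨M, hM⟩ : ∃ M, M = A * ‖f y‖ := ⟨_, rfl⟩
  have hM0 : 0 < M := by rw [hM]; positivity
  obtain ⟨i, hi⟩ := exists_norm_le_mul_abs_apply (by omega) (f y)
  obtain ⟨s, hs, hsi⟩ : ∃ s : ℝ, s * s = 1 ∧ s * f y i = |f y i| := by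
    rcases le_total 0 (f y i) with h | h
    · exact ⟨1, by norm_num, by rw [abs_of_nonneg h, one_mul]⟩
    · exact ⟨-1, by norm_num, by rw [abs_of_nonpos h, neg_one_mul]⟩
  have hdet : ∀ x ∈ ball y R, fderiv ℝ (fun x => M⁻¹ • f x) x = M⁻¹ • fderiv ℝ f x := fun x hx =>
    fderiv_fun_const_smul (hd x hx) _
  have hdd : ∀ x ∈ ball y R, DifferentiableAt ℝ (fun x => M⁻¹ • f x) x := fun x hx =>
    (hd x hx).fun_const_smul _
  have hgi : ∀ x, (M⁻¹ • f x) i = M⁻¹ * f x i := fun x => rfl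
  have hkey := mt (hdg (fun x => M⁻¹ • f x) y R hdd
    (by
      filter_upwards [hqr, ae_restrict_mem measurableSet_ball] with x hx hxR
      rw [hdet x hxR, norm_smul, mul_pow, Real.norm_of_nonneg (by positivity)]
      have : (M⁻¹ • fderiv ℝ f x).det = M⁻¹ ^ n * (fderiv ℝ f x).det := by
        rw [ContinuousLinearMap.det, ContinuousLinearMap.toLinearMap_smul, LinearMap.det_smul,
          finrank_euclideanSpace_fin]
      rw [this, mul_left_comm]
      gcongr)
    (by
      refine MemLp.ae_eq ?_ (hL.const_smul M⁻¹)
      filter_upwards [ae_restrict_mem measurableSet_ball] with x hxR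
      rw [hdet x hxR, Pi.smul_apply])
    (fun x hx => by
      rw [norm_smul, norm_inv, Real.norm_of_nonneg hM0.le, inv_mul_le_one₀ hM0, hM]
      exact hb x hx) i s hs (R / 2) (by positivity) (by linarith)) (by
      rw [not_le, hgi, mul_left_comm, hsi, hθ, inv_mul_eq_div, hM, div_lt_div_iff₀ (by positivity)
        (by positivity)]
      nlinarith [mul_pos hA hy0])
  rw [not_le] at hkey
  have hEm := measurableSet_superlevel (half_lt_self hR) hdd i s (θ / 2)
  set E := {x ∈ closedBall y (R / 2) | θ / 2 < s * (M⁻¹ • f x) i} with hE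
  have hEb : E ⊆ ball y R := fun x hx => closedBall_subset_ball (half_lt_self hR) hx.1
  have hs1 : |s| = 1 := by
    rcases mul_self_eq_one_iff.1 hs with h | h <;> simp [h]
  have hlow : ∀ x ∈ E, (‖f y‖ / (4 * n)) ^ p ≤ ‖f x‖ ^ p := by
    intro x hx
    have h1 : θ / 2 < s * (M⁻¹ * f x i) := hx.2
    refine Real.rpow_le_rpow (by positivity) ?_ hp.le
    have h2 : s * f x i ≤ ‖f x‖ := by
      refine (le_abs_self _).trans ?_
      rw [abs_mul, hs1, one_mul]
      exact PiLp.norm_apply_le (f x) i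
    have h3 : θ / 2 * M < s * f x i := by
      rw [mul_left_comm, inv_mul_eq_div, lt_div_iff₀ hM0] at h1
      exact h1
    have h4 : θ / 2 * M = ‖f y‖ / (4 * n) := by rw [hθ, hM]; field_simp; norm_num
    linarith
  have hvol : ENNReal.ofReal (ν * (R / 2) ^ n) ≤ volume E :=
    (ENNReal.ofReal_le_ofReal hkey.le).trans ENNReal.ofReal_toReal_le
  calc ENNReal.ofReal (‖f y‖ ^ p * R ^ n)
      = ENNReal.ofReal ((4 * n) ^ p * 2 ^ n / ν) *
          (ENNReal.ofReal ((‖f y‖ / (4 * n)) ^ p) * ENNReal.ofReal (ν * (R / 2) ^ n)) := by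
        rw [← ENNReal.ofReal_mul (by positivity), ← ENNReal.ofReal_mul (by positivity),
          Real.div_rpow hy0.le (by positivity), div_pow]
        congr 1
        field_simp
    _ ≤ ENNReal.ofReal ((4 * n) ^ p * 2 ^ n / ν) *
          (ENNReal.ofReal ((‖f y‖ / (4 * n)) ^ p) * volume E) := by gcongr
    _ ≤ _ := by
        gcongr
        rw [← setLIntegral_const]
        refine (setLIntegral_mono_ae' hEm (Eventually.of_forall fun x hx => ?_)).trans
          (lintegral_mono_set hEb)
        exact ENNReal.ofReal_le_ofReal (hlow x hx)

/-- The sub-mean value property of `|f| ^ p` for quasiregular `f`. -/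
theorem rpow_norm_mul_pow_le_lintegral (hn : 2 ≤ n) {K p : ℝ} (hK : 0 < K) (hp : 0 < p) :
    ∃ C : ℝ, 0 < C ∧ ∀ (f : Vec n → Vec n) (U : Set (Vec n)) (x : Vec n) (R : ℝ), IsOpen U →
      closedBall x R ⊆ U → 0 < R → (∀ z ∈ U, DifferentiableAt ℝ f z) →
      (∀ᵐ z ∂(volume.restrict U), ‖fderiv ℝ f z‖ ^ n ≤ K * (fderiv ℝ f z).det) →
      ENNReal.ofReal (‖f x‖ ^ p * R ^ n) ≤
        ENNReal.ofReal C * ∫⁻ z in ball x R, ENNReal.ofReal (‖f z‖ ^ p) := by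
  have hnp : 0 < (n : ℝ) / p := by
    have : 0 < n := by omega
    positivity
  obtain ⟨C, hC, hloc⟩ := rpow_norm_mul_pow_le_of_bounded hn hK
    (A := 2 ^ ((n : ℝ) / p)) (by positivity) hp
  refine ⟨2 ^ n * C, by positivity, ?_⟩
  intro f U x R hU hxU hR hd hqr
  have hcont : ContinuousOn (fun z => ‖f z‖ * (R - dist z x) ^ ((n : ℝ) / p)) (closedBall x R) := by
    refine ContinuousOn.mul (fun z hz => (hd z (hxU hz)).continuousAt.norm.continuousWithinAt) ?_
    exact (continuous_const.sub (continuous_id.dist continuous_const)).continuousOn.rpow_const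
      fun z _ => Or.inr hnp.le
  obtain ⟨y, hy, hmax⟩ := (isCompact_closedBall x R).exists_isMaxOn
    (nonempty_closedBall.2 hR.le) hcont
  have hmax' : ∀ z ∈ closedBall x R, ‖f z‖ * (R - dist z x) ^ ((n : ℝ) / p) ≤
      ‖f y‖ * (R - dist y x) ^ ((n : ℝ) / p) := fun z hz => hmax hz
  have hx := hmax' x (mem_closedBall_self hR.le)
  rw [dist_self, sub_zero] at hx
  by_cases hx0 : f x = 0
  · rw [hx0, norm_zero, Real.zero_rpow hp.ne', zero_mul, ENNReal.ofReal_zero]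
    exact zero_le
  have hpos : 0 < ‖f y‖ * (R - dist y x) ^ ((n : ℝ) / p) :=
    lt_of_lt_of_le (mul_pos (norm_pos_iff.2 hx0) (Real.rpow_pos_of_pos hR _)) hx
  have hy0 : f y ≠ 0 := fun h => by simp [h] at hpos
  have hyR : 0 < R - dist y x := by
    refine lt_of_le_of_ne (sub_nonneg.2 (mem_closedBall.1 hy)) fun h => ?_
    rw [← h, Real.zero_rpow hnp.ne', mul_zero] at hpos
    exact lt_irrefl _ hpos
  obtain ⟨δ, hδ⟩ : ∃ δ, δ = (R - dist y x) / 2 := ⟨_, rfl⟩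
  have hδ0 : 0 < δ := by rw [hδ]; positivity
  have hyδ : R - dist y x = 2 * δ := by rw [hδ]; ring
  rw [hyδ] at hx hmax'
  have hsub : ball y δ ⊆ ball x R := ball_subset_ball' (by linarith)
  have hsubU : ball y δ ⊆ U := (hsub.trans ball_subset_closedBall).trans hxU
  have hmain := hloc f y δ hδ0 (fun z hz => hd z (hsubU hz))
    (ae_mono (Measure.restrict_mono hsubU le_rfl) hqr)
    ((memLp_fderiv_of_isCompact (by omega) hK hU hd hqr (isCompact_closedBall x R) hxU).mono_measure
      (Measure.restrict_mono (hsub.trans ball_subset_closedBall) le_rfl)) hy0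
    (fun z hz => by
      have h1 := hmax' z (ball_subset_closedBall (hsub hz))
      have h2 : δ ≤ R - dist z x := by
        have := dist_triangle z y x
        have := mem_ball.1 hz
        linarith
      have h3 : δ ^ ((n : ℝ) / p) ≤ (R - dist z x) ^ ((n : ℝ) / p) :=
        Real.rpow_le_rpow hδ0.le h2 hnp.le
      rw [Real.mul_rpow two_pos.le hδ0.le] at h1
      have h4 : 0 < δ ^ ((n : ℝ) / p) := Real.rpow_pos_of_pos hδ0 _
      have h5 : ‖f z‖ * δ ^ ((n : ℝ) / p) ≤ 2 ^ ((n : ℝ) / p) * ‖f y‖ * δ ^ ((n : ℝ) / p) := by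
        have := mul_le_mul_of_nonneg_left h3 (norm_nonneg (f z))
        linarith
      exact le_of_mul_le_mul_right h5 h4)
  have hpow : ∀ (v : Vec n) {t : ℝ}, 0 ≤ t →
      (‖v‖ * t ^ ((n : ℝ) / p)) ^ p = ‖v‖ ^ p * t ^ n := fun v t ht => by
    rw [Real.mul_rpow (norm_nonneg v) (Real.rpow_nonneg ht _), ← Real.rpow_mul ht,
      div_mul_cancel₀ _ hp.ne', Real.rpow_natCast]
  have hx2 : ‖f x‖ ^ p * R ^ n ≤ 2 ^ n * (‖f y‖ ^ p * δ ^ n) := by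
    have := Real.rpow_le_rpow (by positivity) hx hp.le
    rw [hpow _ hR.le, hpow _ (by positivity), mul_pow] at this
    linarith
  calc _ ≤ ENNReal.ofReal (2 ^ n * (‖f y‖ ^ p * δ ^ n)) := ENNReal.ofReal_le_ofReal hx2
    _ = ENNReal.ofReal (2 ^ n) * ENNReal.ofReal (‖f y‖ ^ p * δ ^ n) :=
        ENNReal.ofReal_mul (by positivity)
    _ ≤ ENNReal.ofReal (2 ^ n) *
          (ENNReal.ofReal C * ∫⁻ z in ball x R, ENNReal.ofReal (‖f z‖ ^ p)) := by
        gcongr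
        exact hmain.trans (by gcongr)
    _ = _ := by rw [← mul_assoc, ← ENNReal.ofReal_mul (by positivity)]

end MeanValue

section SphereMeasure
variable {n : ℕ}

theorem norm_normalize_sub_normalize_le {E : Type*} [NormedAddCommGroup E] [NormedSpace ℝ E]
    {x y : E} (hx : 1 ≤ ‖x‖) (hy : y ≠ 0) :
    ‖‖x‖⁻¹ • x - ‖y‖⁻¹ • y‖ ≤ 2 * ‖x - y‖ := by
  have hx0 : 0 < ‖x‖ := by linarith
  have hy0 : 0 < ‖y‖ := norm_pos_iff.2 hy
  have h1 : ‖x‖⁻¹ • x - ‖y‖⁻¹ • y = ‖x‖⁻¹ • (x - y) + (‖x‖⁻¹ - ‖y‖⁻¹) • y := by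
    rw [smul_sub, sub_smul]; abel
  have h2 : ‖(‖x‖⁻¹ - ‖y‖⁻¹) • y‖ = ‖x‖⁻¹ * |‖y‖ - ‖x‖| := by
    have : ‖x‖⁻¹ - ‖y‖⁻¹ = ‖x‖⁻¹ * (‖y‖ - ‖x‖) * ‖y‖⁻¹ := by field_simp
    rw [norm_smul, this, norm_mul, norm_mul, norm_inv, norm_inv, norm_norm, norm_norm,
      Real.norm_eq_abs, inv_mul_cancel_right₀ hy0.ne']
  rw [h1]
  refine (norm_add_le _ _).trans ?_
  rw [h2, norm_smul, norm_inv, norm_norm]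
  have h3 : |‖y‖ - ‖x‖| ≤ ‖x - y‖ := by rw [abs_sub_comm]; exact abs_norm_sub_norm_le x y
  have h4 : ‖x‖⁻¹ ≤ 1 := inv_le_one_of_one_le₀ hx
  have h5 : 0 ≤ ‖x‖⁻¹ := inv_nonneg.2 hx0.le
  nlinarith [norm_nonneg (x - y), abs_nonneg (‖y‖ - ‖x‖)]

/-- The central projection onto the sphere of a face of the cube. -/
def faceProj (m : ℕ) (i : Fin (m + 1)) (s : ℝ) (v : Fin m → ℝ) : Vec (m + 1) :=
  ‖(WithLp.toLp 2 (i.insertNth s v : Fin (m + 1) → ℝ) : Vec (m + 1))‖⁻¹ •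
    WithLp.toLp 2 (i.insertNth s v : Fin (m + 1) → ℝ)

theorem lipschitzWith_insertNth (m : ℕ) (i : Fin (m + 1)) (s : ℝ) :
    LipschitzWith 1 fun v : Fin m → ℝ => (i.insertNth s v : Fin (m + 1) → ℝ) := by
  refine LipschitzWith.of_dist_le_mul fun v w => ?_
  rw [NNReal.coe_one, one_mul, dist_pi_le_iff dist_nonneg]
  intro j
  refine Fin.succAboveCases i ?_ (fun k => ?_) j
  · simp
  · simpa using dist_le_pi_dist v w k

theorem exists_lipschitzWith_faceProj (m : ℕ) (i : Fin (m + 1)) {s : ℝ} (hs : |s| = 1) :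
    ∃ C : ℝ≥0, LipschitzWith C (faceProj m i s) := by
  have h1 := (PiLp.lipschitzWith_toLp 2 fun _ : Fin (m + 1) => ℝ).comp
    (lipschitzWith_insertNth m i s)
  refine ⟨2 * ((Fintype.card (Fin (m + 1)) : ℝ≥0) ^ (1 / (2 : ℝ≥0∞)).toReal * 1),
    LipschitzWith.of_dist_le_mul fun v w => ?_⟩
  have hge : ∀ v : Fin m → ℝ,
      1 ≤ ‖(WithLp.toLp 2 (i.insertNth s v : Fin (m + 1) → ℝ) : Vec (m + 1))‖ := fun v => by
    have := PiLp.norm_apply_le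
      (WithLp.toLp 2 (i.insertNth s v : Fin (m + 1) → ℝ) : Vec (m + 1)) i
    simpa [hs] using this
  have hne : (WithLp.toLp 2 (i.insertNth s w : Fin (m + 1) → ℝ) : Vec (m + 1)) ≠ 0 := fun h => by
    have := hge w
    rw [h, norm_zero] at this
    linarith
  rw [dist_eq_norm, faceProj, faceProj]
  refine (norm_normalize_sub_normalize_le (hge v) hne).trans ?_
  rw [NNReal.coe_mul, mul_assoc]
  refine mul_le_mul_of_nonneg_left ?_ two_pos.le
  rw [← dist_eq_norm]
  exact h1.dist_le_mul v w

theorem unitSphere_subset_iUnion_faceProj (m : ℕ) :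
    unitSphere (m + 1) ⊆ ⋃ i : Fin (m + 1), ⋃ s ∈ ({1, -1} : Finset ℝ),
      faceProj m i s '' Icc (-1) 1 := by
  intro x hx
  have hx1 : ‖x‖ = 1 := mem_sphere_zero_iff_norm.1 hx
  obtain ⟨i, -, hi⟩ := Finset.exists_max_image Finset.univ (fun i => |x i|) Finset.univ_nonempty
  have hxi : 0 < |x i| := by
    refine lt_of_le_of_ne (abs_nonneg _) fun h => ?_
    have : x = 0 := by
      ext j
      exact abs_nonpos_iff.1 ((hi j (Finset.mem_univ j)).trans h.symm.le)
    rw [this, norm_zero] at hx1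
    exact zero_ne_one hx1
  have hmem : |x i|⁻¹ * x i ∈ ({1, -1} : Finset ℝ) := by
    rcases le_total 0 (x i) with h | h
    · rw [abs_of_nonneg h] at hxi ⊢
      simp [inv_mul_cancel₀ hxi.ne']
    · rw [abs_of_nonpos h] at hxi ⊢
      have : x i ≠ 0 := (neg_pos.1 hxi).ne
      rw [inv_neg, neg_mul, inv_mul_cancel₀ this]
      simp
  refine mem_iUnion.2 ⟨i, mem_iUnion₂.2 ⟨|x i|⁻¹ * x i, hmem,
    fun j => |x i|⁻¹ * x (i.succAbove j), ?_, ?_⟩⟩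
  · have hb : ∀ j, |(|x i|⁻¹ * x (i.succAbove j))| ≤ 1 := fun j => by
      rw [abs_mul, abs_inv, abs_abs, inv_mul_le_one₀ hxi]
      exact hi _ (Finset.mem_univ _)
    exact ⟨fun j => (abs_le.1 (hb j)).1, fun j => (abs_le.1 (hb j)).2⟩
  · have : (WithLp.toLp 2 (i.insertNth (|x i|⁻¹ * x i)
        (fun j => |x i|⁻¹ * x (i.succAbove j)) : Fin (m + 1) → ℝ) : Vec (m + 1)) =
        |x i|⁻¹ • x := by
      ext j
      refine Fin.succAboveCases i ?_ (fun k => ?_) j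
      · simp
      · simp
    rw [faceProj, this, norm_smul, hx1, mul_one, norm_inv, Real.norm_of_nonneg (abs_nonneg _),
      inv_inv, smul_smul, mul_inv_cancel₀ hxi.ne', one_smul]

/-- The unit sphere has finite surface measure. -/
theorem sphMeasure_unitSphere_lt_top (hn : n ≠ 0) : sphMeasure n (unitSphere n) < ⊤ := by
  obtain ⟨m, rfl⟩ : ∃ m, n = m + 1 := ⟨n - 1, by omega⟩
  have hd : ((m + 1 : ℕ) : ℝ) - 1 = m := by push_cast; ring
  refine (Measure.restrict_apply_le _ _).trans_lt ?_
  rw [hd]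
  refine (measure_mono (unitSphere_subset_iUnion_faceProj m)).trans_lt ?_
  rw [← biUnion_univ]
  refine measure_biUnion_lt_top finite_univ fun i _ => ?_
  refine measure_biUnion_lt_top (Finset.finite_toSet _) fun s hs => ?_
  have hs1 : |s| = 1 := by
    rcases Finset.mem_insert.1 (Finset.mem_coe.1 hs) with h | h
    · simp [h]
    · simp [Finset.mem_singleton.1 h]
  obtain ⟨C, hC⟩ := exists_lipschitzWith_faceProj m i hs1
  refine (hC.hausdorffMeasure_image_le (Nat.cast_nonneg m) _).trans_lt ?_
  have hv : (μH[(m : ℝ)] : Measure (Fin m → ℝ)) = volume := by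
    have := hausdorffMeasure_pi_real (ι := Fin m)
    rwa [Fintype.card_fin] at this
  rw [hv]
  exact ENNReal.mul_lt_top (by finiteness) isCompact_Icc.measure_lt_top

end SphereMeasure

section ToSphere
open scoped Pointwise
variable {m : ℕ}

/-- A thin sector is covered by few small balls. -/
theorem sector_subset_biUnion_closedBall {x : Vec (m + 1)} {d : ℝ} (hd : 0 < d)
    {s : Set (Vec (m + 1))} (hs : ∀ w ∈ s, dist w x ≤ d) (hx : ‖x‖ = 1) :
    Ioo (0 : ℝ) 1 • s ⊆ ⋃ k ∈ Finset.range (⌊1 / d⌋₊ + 1),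
      closedBall (((k : ℝ) * d) • x) (2 * d) := by
  rintro _ ⟨t, ht, w, hw, rfl⟩
  refine mem_iUnion₂.2 ⟨⌊t / d⌋₊, ?_, ?_⟩
  · rw [Finset.mem_range, Nat.lt_succ_iff]
    exact Nat.floor_mono (div_le_div_of_nonneg_right ht.2.le hd.le)
  · rw [mem_closedBall, dist_eq_norm]
    have h1 : t • w - ((⌊t / d⌋₊ : ℝ) * d) • x = t • (w - x) + (t - ⌊t / d⌋₊ * d) • x := by
      rw [smul_sub, sub_smul]; abel
    change ‖t • w - ((⌊t / d⌋₊ : ℝ) * d) • x‖ ≤ 2 * d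
    rw [h1]
    refine (norm_add_le _ _).trans ?_
    rw [norm_smul, norm_smul, hx, mul_one, Real.norm_of_nonneg ht.1.le, ← dist_eq_norm]
    have h2 : (⌊t / d⌋₊ : ℝ) * d ≤ t := by
      rw [← le_div_iff₀ hd]; exact Nat.floor_le (div_nonneg ht.1.le hd.le)
    have h3 : t < (⌊t / d⌋₊ + 1 : ℝ) * d := by
      rw [← div_lt_iff₀ hd]; exact Nat.lt_floor_add_one _
    rw [Real.norm_of_nonneg (sub_nonneg.2 h2)]
    have h4 : t * dist w x ≤ d :=
      (mul_le_of_le_one_left dist_nonneg ht.2.le).trans (hs w hw)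
    linarith

theorem exists_toSphere_closedBall_le (m : ℕ) :
    ∃ c : ℝ, 0 < c ∧ ∀ (x : sphere (0 : Vec (m + 1)) 1) (d : ℝ), 0 < d → d ≤ 1 →
      (volume : Measure (Vec (m + 1))).toSphere (closedBall x d) ≤ ENNReal.ofReal (c * d ^ m) := by
  obtain ⟨V, hV0, hV⟩ : ∃ V : ℝ, 0 ≤ V ∧
      volume (ball (0 : Vec (m + 1)) 1) = ENNReal.ofReal V := by
    have hfin : volume (ball (0 : Vec (m + 1)) 1) ≠ ⊤ := measure_ball_lt_top.ne
    exact ⟨_, ENNReal.toReal_nonneg, (ENNReal.ofReal_toReal hfin).symm⟩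
  refine ⟨(m + 1) * (2 ^ (m + 2) * V) + 1, by positivity, fun x d hd hd1 => ?_⟩
  rw [Measure.toSphere_apply' _ isClosed_closedBall.measurableSet, finrank_euclideanSpace_fin]
  have hx : ‖(x : Vec (m + 1))‖ = 1 := mem_sphere_zero_iff_norm.1 x.2
  have hvol : ∀ z : Vec (m + 1), volume (closedBall z (2 * d)) =
      ENNReal.ofReal ((2 * d) ^ (m + 1) * V) := fun z => by
    rw [Measure.addHaar_closedBall _ _ (by positivity), finrank_euclideanSpace_fin,
      ENNReal.ofReal_mul (by positivity), hV]
  have hsub : ∀ w ∈ Subtype.val '' closedBall x d, dist w (x : Vec (m + 1)) ≤ d := by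
    rintro _ ⟨w, hw, rfl⟩
    exact hw
  have hcov := sector_subset_biUnion_closedBall hd hsub hx
  have h1 : volume (Ioo (0 : ℝ) 1 • (Subtype.val '' closedBall x d)) ≤
      ENNReal.ofReal (2 ^ (m + 2) * V * d ^ m) := by
    refine (measure_mono hcov).trans ?_
    refine (measure_biUnion_finset_le _ _).trans ?_
    simp only [hvol, Finset.sum_const, Finset.card_range, nsmul_eq_mul]
    rw [← ENNReal.ofReal_natCast, ← ENNReal.ofReal_mul (by positivity)]
    apply ENNReal.ofReal_le_ofReal
    have h2 : ((⌊1 / d⌋₊ + 1 : ℕ) : ℝ) * d ≤ 2 := by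
      have : (⌊1 / d⌋₊ : ℝ) * d ≤ 1 := by
        rw [← le_div_iff₀ hd]; exact Nat.floor_le (by positivity)
      push_cast
      linarith
    calc _ = ((⌊1 / d⌋₊ + 1 : ℕ) : ℝ) * d * (2 ^ (m + 1) * d ^ m * V) := by ring
      _ ≤ 2 * (2 ^ (m + 1) * d ^ m * V) := by gcongr
      _ = _ := by ring
  calc _ ≤ ((m + 1 : ℕ) : ℝ≥0∞) * ENNReal.ofReal (2 ^ (m + 2) * V * d ^ m) := by gcongr
    _ = ENNReal.ofReal ((m + 1) * (2 ^ (m + 2) * V) * d ^ m) := by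
      rw [← ENNReal.ofReal_natCast, ← ENNReal.ofReal_mul (by positivity)]
      push_cast
      ring_nf
    _ ≤ _ := by
      apply ENNReal.ofReal_le_ofReal
      gcongr
      linarith

/-- The polar-coordinates surface measure is dominated by the Hausdorff surface measure. -/
theorem exists_map_toSphere_le_sphMeasure (m : ℕ) :
    ∃ c : ℝ, 0 < c ∧ ((volume : Measure (Vec (m + 1))).toSphere).map Subtype.val ≤
      ENNReal.ofReal c • sphMeasure (m + 1) := by
  obtain ⟨c, hc, hball⟩ := exists_toSphere_closedBall_le m
  have hc0 : ENNReal.ofReal c ≠ 0 := (ENNReal.ofReal_pos.2 hc).ne'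
  have hle : (ENNReal.ofReal c)⁻¹ • (volume : Measure (Vec (m + 1))).toSphere ≤ μH[(m : ℝ)] := by
    refine Measure.le_hausdorffMeasure _ _ (1 / 2) (by norm_num) fun s hs => ?_
    rcases s.eq_empty_or_nonempty with rfl | ⟨x, hx⟩
    · rw [measure_empty]; exact zero_le
    have hfin : ediam s ≠ ⊤ := (hs.trans_lt (by norm_num)).ne
    obtain ⟨e, he⟩ : ∃ e, e = (ediam s).toReal := ⟨_, rfl⟩
    have he0 : 0 ≤ e := by rw [he]; exact ENNReal.toReal_nonneg
    have hes : ediam s = ENNReal.ofReal e := by rw [he, ENNReal.ofReal_toReal hfin]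
    have he1 : e < 1 := by
      rw [hes] at hs
      have : ENNReal.ofReal e < 1 := hs.trans_lt (by norm_num)
      simpa using this
    have hd : ∀ d ∈ Ioc e 1, (volume : Measure (Vec (m + 1))).toSphere s ≤
        ENNReal.ofReal (c * d ^ m) := fun d hd => by
      refine (measure_mono fun w hw => ?_).trans (hball x d (he0.trans_lt hd.1) hd.2)
      have h1 : edist w x ≤ ediam s := edist_le_ediam_of_mem hw hx
      rw [hes, edist_dist] at h1
      exact ((ENNReal.ofReal_le_ofReal_iff he0).1 h1).trans hd.1.le
    have hlim : Tendsto (fun d : ℝ => ENNReal.ofReal (c * d ^ m)) (𝓝[>] e)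
        (𝓝 (ENNReal.ofReal (c * e ^ m))) :=
      ((ENNReal.continuous_ofReal.comp (by fun_prop)).tendsto e).mono_left nhdsWithin_le_nhds
    have h2 := ge_of_tendsto hlim (Filter.mem_of_superset (Ioc_mem_nhdsGT he1) hd)
    rw [Measure.smul_apply, smul_eq_mul, hes, ENNReal.rpow_natCast, ← ENNReal.ofReal_pow he0]
    rw [ENNReal.ofReal_mul hc.le] at h2
    rw [← ENNReal.div_eq_inv_mul]
    exact ENNReal.div_le_of_le_mul' h2
  refine ⟨c, hc, ?_⟩
  have hmap : (μH[(m : ℝ)] : Measure (sphere (0 : Vec (m + 1)) 1)).map Subtype.val =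
      sphMeasure (m + 1) := by
    rw [isometry_subtype_coe.map_hausdorffMeasure (Or.inl (Nat.cast_nonneg m)),
      Subtype.range_coe, sphMeasure, unitSphere]
    congr 2
    push_cast
    ring
  have h3 : (volume : Measure (Vec (m + 1))).toSphere ≤ ENNReal.ofReal c • μH[(m : ℝ)] := by
    refine Measure.le_iff'.2 fun s => ?_
    have := Measure.le_iff'.1 hle s
    rw [Measure.smul_apply, smul_eq_mul] at this ⊢
    rw [← ENNReal.div_eq_inv_mul] at this
    rwa [ENNReal.div_le_iff' hc0 ENNReal.ofReal_ne_top] at this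
  calc _ ≤ (ENNReal.ofReal c • (μH[(m : ℝ)] : Measure (sphere (0 : Vec (m + 1)) 1))).map Subtype.val :=
        Measure.map_mono h3 measurable_subtype_coe
    _ = _ := by rw [Measure.map_smul, hmap]

end ToSphere

section Polar
variable {m : ℕ}

/-- Polar coordinates for the Lebesgue integral. -/
theorem lintegral_eq_lintegral_toSphere {g : Vec (m + 1) → ℝ≥0∞} (hg : Measurable g) :
    ∫⁻ z, g z = ∫⁻ r in Ioi (0 : ℝ), ENNReal.ofReal (r ^ m) *
      ∫⁻ w, g (r • w) ∂((volume : Measure (Vec (m + 1))).toSphere.map Subtype.val) := by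
  have hmp := (volume : Measure (Vec (m + 1))).measurePreserving_homeomorphUnitSphereProd
  rw [finrank_euclideanSpace_fin, Nat.add_sub_cancel] at hmp
  obtain ⟨G, hG⟩ : ∃ G : sphere (0 : Vec (m + 1)) 1 × Ioi (0 : ℝ) → ℝ≥0∞,
      G = fun q => g (q.2.1 • q.1.1) := ⟨_, rfl⟩
  have hGm : Measurable G := by
    rw [hG]; exact hg.comp (by fun_prop)
  have h1 : ∫⁻ z, g z = ∫⁻ q, G q ∂((volume : Measure (Vec (m + 1))).toSphere.prod
      (Measure.volumeIoiPow m)) := by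
    rw [← hmp.lintegral_comp hGm]
    have h2 : ∀ z : ({0}ᶜ : Set (Vec (m + 1))), G (homeomorphUnitSphereProd _ z) = g z := by
      intro z
      have := homeomorphUnitSphereProd_symm_apply_coe (Vec (m + 1)) (homeomorphUnitSphereProd _ z)
      rw [Homeomorph.symm_apply_apply] at this
      rw [hG, this]
    simp_rw [h2]
    rw [lintegral_subtype_comap (measurableSet_singleton _).compl, restrict_compl_singleton]
  rw [h1, lintegral_prod_symm' _ hGm, Measure.volumeIoiPow,
    lintegral_withDensity_eq_lintegral_mul _ (by fun_prop) hGm.lintegral_prod_left',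
    ← lintegral_subtype_comap measurableSet_Ioi]
  refine lintegral_congr fun r => ?_
  have hgr : Measurable fun w => g ((r : ℝ) • w) := hg.comp (measurable_const_smul _)
  rw [lintegral_map hgr measurable_subtype_coe, hG]
  rfl

theorem lintegral_sphMeasure_le_hardyMean {n : ℕ} (hn : n ≠ 0) (p : ℝ) (f : Vec n → Vec n)
    (r : ℝ) : ∫⁻ w, ENNReal.ofReal (‖f (r • w)‖ ^ p) ∂(sphMeasure n) ≤
      sphMeasure n (unitSphere n) * hardyMean n p f r := by
  by_cases h0 : sphMeasure n (unitSphere n) = 0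
  · have h1 : sphMeasure n = 0 := by
      rw [sphMeasure, Measure.restrict_apply_self] at h0
      rw [sphMeasure, Measure.restrict_eq_zero, h0]
    rw [h1, lintegral_zero_measure]
    exact zero_le
  · rw [hardyMean, ← mul_assoc,
      ENNReal.mul_inv_cancel h0 (sphMeasure_unitSphere_lt_top hn).ne, one_mul]

theorem hardyMean_le_hardyNorm_rpow {n : ℕ} {p : ℝ} (hp : 0 < p) (f : Vec n → Vec n) {r : ℝ}
    (hr : r ∈ Ioo (0 : ℝ) 1) : hardyMean n p f r ≤ hardyNorm n p f ^ p := by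
  rw [hardyNorm, ← ENNReal.rpow_mul, one_div_mul_cancel hp.ne', ENNReal.rpow_one]
  exact le_iSup₂ (f := fun r (_ : r ∈ Ioo (0 : ℝ) 1) => hardyMean n p f r) r hr

/-- The integral of `|f| ^ p` over a ball is controlled by the Hardy norm. -/
theorem exists_lintegral_ball_le_hardyNorm {n : ℕ} (hn : n ≠ 0) :
    ∃ C : ℝ, 0 < C ∧ ∀ (p : ℝ) (f : Vec n → Vec n) (x : Vec n) (R : ℝ), 0 < p → 0 < R →
      ‖x‖ + R < 1 → ContinuousOn f (unitBall n) →
      ∫⁻ z in ball x R, ENNReal.ofReal (‖f z‖ ^ p) ≤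
        ENNReal.ofReal (C * R) * hardyNorm n p f ^ p := by
  obtain ⟨m, rfl⟩ := Nat.exists_eq_succ_of_ne_zero hn
  simp only [Nat.succ_eq_add_one] at *
  obtain ⟨c, hc, hle⟩ := exists_map_toSphere_le_sphMeasure m
  have hfin := (sphMeasure_unitSphere_lt_top hn).ne
  obtain ⟨S, hS⟩ : ∃ S, S = (sphMeasure (m + 1) (unitSphere (m + 1))).toReal := ⟨_, rfl⟩
  have hS0 : 0 ≤ S := by rw [hS]; exact ENNReal.toReal_nonneg
  have hSS : sphMeasure (m + 1) (unitSphere (m + 1)) = ENNReal.ofReal S := by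
    rw [hS, ENNReal.ofReal_toReal hfin]
  refine ⟨2 * c * (S + 1), by positivity, fun p f x R hp hR hxR hf => ?_⟩
  have hsub : ball x R ⊆ unitBall (m + 1) := ball_subset_ball' (by rw [dist_zero_right]; linarith)
  obtain ⟨g, hg⟩ : ∃ g : Vec (m + 1) → ℝ≥0∞,
      g = (ball x R).indicator fun z => ENNReal.ofReal (‖f z‖ ^ p) := ⟨_, rfl⟩
  have hgm : Measurable g := by
    have h1 : ContinuousOn (fun z => ENNReal.ofReal (‖f z‖ ^ p)) (ball x R) :=
      ENNReal.continuous_ofReal.comp_continuousOn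
        ((hf.mono hsub).norm.rpow_const fun _ _ => Or.inr hp.le)
    have h2 := h1.measurable_piecewise (g := fun _ => 0) continuousOn_const measurableSet_ball
    rw [hg]
    convert h2 using 1
    ext z
    by_cases hz : z ∈ ball x R <;> simp [hz]
  obtain ⟨H, hH⟩ : ∃ H, H = hardyNorm (m + 1) p f ^ p := ⟨_, rfl⟩
  have hinner : ∀ r ∈ Ioi (0 : ℝ), ENNReal.ofReal (r ^ m) *
      ∫⁻ w, g (r • w) ∂((volume : Measure (Vec (m + 1))).toSphere.map Subtype.val) ≤
      (Ioo (‖x‖ - R) (‖x‖ + R)).indicator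
        (fun _ => ENNReal.ofReal c * (ENNReal.ofReal S * H)) r := by
    intro r hr
    have hr0 : 0 < r := hr
    have h1 : ∫⁻ w, g (r • w) ∂((volume : Measure (Vec (m + 1))).toSphere.map Subtype.val) ≤
        ENNReal.ofReal c * ∫⁻ w, g (r • w) ∂(sphMeasure (m + 1)) := by
      refine (lintegral_mono' hle le_rfl).trans ?_
      rw [lintegral_smul_measure, smul_eq_mul]
    by_cases hrI : r ∈ Ioo (‖x‖ - R) (‖x‖ + R)
    · rw [indicator_of_mem hrI]
      have hr1 : r < 1 := hrI.2.trans hxR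
      have h2 : ENNReal.ofReal (r ^ m) ≤ 1 :=
        ENNReal.ofReal_le_one.2 (pow_le_one₀ hr0.le hr1.le)
      refine (mul_le_of_le_one_left zero_le h2).trans (h1.trans ?_)
      gcongr
      calc ∫⁻ w, g (r • w) ∂(sphMeasure (m + 1))
          ≤ ∫⁻ w, ENNReal.ofReal (‖f (r • w)‖ ^ p) ∂(sphMeasure (m + 1)) := by
            refine lintegral_mono fun w => ?_
            rw [hg]
            exact indicator_le_self _ _ _
        _ ≤ _ := lintegral_sphMeasure_le_hardyMean hn p f r
        _ ≤ _ := by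
            rw [hSS, hH]
            gcongr
            exact hardyMean_le_hardyNorm_rpow hp f ⟨hr0, hr1⟩
    · rw [indicator_of_notMem hrI]
      have h3 : ∫⁻ w, g (r • w) ∂(sphMeasure (m + 1)) = 0 := by
        rw [sphMeasure, unitSphere, setLIntegral_congr_fun (g := fun _ => 0)
          (isClosed_sphere (x := (0 : Vec (m + 1))) (ε := 1)).measurableSet,
          lintegral_zero]
        intro w hw
        have hw1 : ‖w‖ = 1 := mem_sphere_zero_iff_norm.1 hw
        dsimp only
        rw [hg]
        refine indicator_of_notMem (fun hz => hrI ?_) _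
        rw [mem_ball, dist_eq_norm] at hz
        have h4 := (abs_norm_sub_norm_le (r • w) x).trans_lt hz
        rw [norm_smul, hw1, mul_one, Real.norm_of_nonneg hr0.le, abs_lt] at h4
        exact ⟨by linarith, by linarith⟩
      rw [h3, mul_zero] at h1
      rw [le_antisymm h1 zero_le, mul_zero]
  calc ∫⁻ z in ball x R, ENNReal.ofReal (‖f z‖ ^ p) = ∫⁻ z, g z := by
        rw [hg, lintegral_indicator measurableSet_ball]
    _ = _ := lintegral_eq_lintegral_toSphere hgm
    _ ≤ ∫⁻ r in Ioi (0 : ℝ), (Ioo (‖x‖ - R) (‖x‖ + R)).indicator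
          (fun _ => ENNReal.ofReal c * (ENNReal.ofReal S * H)) r :=
        setLIntegral_mono' measurableSet_Ioi hinner
    _ ≤ ∫⁻ r, (Ioo (‖x‖ - R) (‖x‖ + R)).indicator
          (fun _ => ENNReal.ofReal c * (ENNReal.ofReal S * H)) r := setLIntegral_le_lintegral _ _
    _ = ENNReal.ofReal (c * S * (2 * R)) * H := by
        rw [lintegral_indicator measurableSet_Ioo, setLIntegral_const, Real.volume_Ioo,
          show ‖x‖ + R - (‖x‖ - R) = 2 * R by ring,
          ENNReal.ofReal_mul (p := c * S) (by positivity), ENNReal.ofReal_mul hc.le]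
        ring
    _ ≤ _ := by
        rw [← hH, show 2 * c * (S + 1) * R = c * (S + 1) * (2 * R) by ring]
        gcongr
        linarith

end Polar

theorem hp_growth_estimate (n : ℕ) (hn : 2 ≤ n) (K p : ℝ) (hK : 1 ≤ K) (hp : 0 < p) :
    ∃ C : ℝ, 0 < C ∧ ∀ f : Vec n → Vec n, IsQR n K f → MemHp n p f →
      ∀ x ∈ unitBall n,
        ‖f x‖ ^ p ≤ C * (hardyNorm n p f).toReal ^ p / (1 - ‖x‖) ^ ((n : ℝ) - 1) := by
  obtain ⟨C₁, hC₁, hmean⟩ := rpow_norm_mul_pow_le_lintegral hn (zero_lt_one.trans_le hK) hp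
  obtain ⟨C₂, hC₂, hint⟩ := exists_lintegral_ball_le_hardyNorm (n := n) (by omega)
  refine ⟨C₁ * C₂ * 2 ^ (n - 1), by positivity, fun f hf hfp x hx => ?_⟩
  obtain ⟨hfc, hfd, hqr⟩ := hf
  have hx1 : ‖x‖ < 1 := mem_ball_zero_iff.1 hx
  obtain ⟨R, hR⟩ : ∃ R, R = (1 - ‖x‖) / 2 := ⟨_, rfl⟩
  have hR0 : 0 < R := by rw [hR]; linarith
  have hsub : closedBall x R ⊆ unitBall n :=
    closedBall_subset_ball' (by rw [dist_zero_right]; linarith)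
  have h1 := (hmean f (unitBall n) x R isOpen_ball hsub hR0 hfd hqr).trans
    (mul_le_mul_right (hint p f x R hp hR0 (by linarith) hfc) (ENNReal.ofReal C₁))
  obtain ⟨N, hN⟩ : ∃ N, N = (hardyNorm n p f).toReal := ⟨_, rfl⟩
  have hN0 : 0 ≤ N := by rw [hN]; exact ENNReal.toReal_nonneg
  have hNN : hardyNorm n p f = ENNReal.ofReal N := by
    rw [hN, ENNReal.ofReal_toReal (ne_of_lt hfp)]
  rw [hNN, ENNReal.ofReal_rpow_of_nonneg hN0 hp.le, ← ENNReal.ofReal_mul (by positivity),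
    ← ENNReal.ofReal_mul hC₁.le, ENNReal.ofReal_le_ofReal_iff (by positivity)] at h1
  rw [← hN]
  obtain ⟨m, rfl⟩ : ∃ m, n = m + 1 := ⟨n - 1, by omega⟩
  rw [Nat.add_sub_cancel, Nat.cast_add_one, add_sub_cancel_right, Real.rpow_natCast,
    show 1 - ‖x‖ = 2 * R by rw [hR]; ring, mul_pow, le_div_iff₀ (by positivity)]
  have h2 : ‖f x‖ ^ p * R ^ m ≤ C₁ * C₂ * N ^ p := by
    refine le_of_mul_le_mul_right ?_ hR0
    calc _ = ‖f x‖ ^ p * R ^ (m + 1) := by ring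
      _ ≤ _ := h1
      _ = _ := by ring
  calc _ = 2 ^ m * (‖f x‖ ^ p * R ^ m) := by ring
    _ ≤ 2 ^ m * (C₁ * C₂ * N ^ p) := by gcongr
    _ = _ := by ring

end
end

section
/- (Harnack inequality for quasiregular mappings.) Let f : B → ℝⁿ \ {0} be a K-quasiregular mapping in the Miniowitz class (Min) with constants C₀, α. Then for every 0 < k < (√5 − 1)/2, every x ∈ B and all y, z ∈ B(x, k(1−|x|)), one has |f(y)|/|f(z)| ≤ 2^α C₀² / (1 − k(k+1))^{2α}; in particular |f(y)|/|f(z)| is bounded above and below by positive constants depending only on C₀, α and k. -/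
open MeasureTheory Metric Set Filter
open scoped ENNReal NNReal Topology Classical

noncomputable section

theorem mobiusT_eq (n : ℕ) (x y : Vec n) :
    mobiusT n x y = (1 - 2 * inner ℝ x y + ‖x‖ ^ 2 * ‖y‖ ^ 2)⁻¹ •
      ((1 - ‖x‖ ^ 2) • y - (1 + ‖y‖ ^ 2 - 2 * inner ℝ x y) • x) := by
  unfold mobiusT
  split_ifs with hx
  · simp [hx]
  · have hx' : ‖x‖ ≠ 0 := norm_ne_zero_iff.2 hx
    have hden : ‖x‖ ^ 2 * ‖y - (‖x‖ ^ 2)⁻¹ • x‖ ^ 2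
        = 1 - 2 * inner ℝ x y + ‖x‖ ^ 2 * ‖y‖ ^ 2 := by
      rw [norm_sub_sq_real, norm_smul, inner_smul_right, real_inner_comm]
      simp only [norm_inv, norm_pow, norm_norm]
      field_simp
      ring
    rw [hden, norm_sub_sq_real, real_inner_comm]
    congr 1
    module

theorem mobiusT_zero_right (n : ℕ) (x : Vec n) : mobiusT n x 0 = -x := by
  simp [mobiusT_eq]

theorem mobius_denom_ge (n : ℕ) (x y : Vec n) :
    (1 - ‖x‖ * ‖y‖) ^ 2 ≤ 1 - 2 * inner ℝ x y + ‖x‖ ^ 2 * ‖y‖ ^ 2 := by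
  nlinarith [real_inner_le_norm x y]

theorem norm_mobiusT_sq (n : ℕ) (x y : Vec n)
    (hD : 1 - 2 * inner ℝ x y + ‖x‖ ^ 2 * ‖y‖ ^ 2 ≠ 0) :
    ‖mobiusT n x y‖ ^ 2 =
      ‖y - x‖ ^ 2 / (1 - 2 * inner ℝ x y + ‖x‖ ^ 2 * ‖y‖ ^ 2) := by
  rw [mobiusT_eq, norm_smul, mul_pow, norm_sub_sq_real, norm_sub_sq_real, norm_smul, norm_smul,
    inner_smul_left, inner_smul_right, real_inner_comm x y]
  simp only [mul_pow, Real.norm_eq_abs, sq_abs, conj_trivial]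
  field_simp
  ring

theorem inner_mobiusT (n : ℕ) (x y : Vec n) :
    inner ℝ x (mobiusT n x y) =
      ((1 - ‖x‖ ^ 2) * inner ℝ x y - (1 + ‖y‖ ^ 2 - 2 * inner ℝ x y) * ‖x‖ ^ 2) /
        (1 - 2 * inner ℝ x y + ‖x‖ ^ 2 * ‖y‖ ^ 2) := by
  rw [mobiusT_eq, inner_smul_right, inner_sub_right, inner_smul_right, inner_smul_right,
    real_inner_self_eq_norm_sq]
  ring

theorem mobiusT_neg_mobiusT (n : ℕ) {x y : Vec n} (hx : ‖x‖ < 1) (hy : ‖y‖ < 1) :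
    mobiusT n (-x) (mobiusT n x y) = y := by
  have hxy : ‖x‖ * ‖y‖ < 1 := by nlinarith [norm_nonneg x, norm_nonneg y]
  have hD : 1 - 2 * inner ℝ x y + ‖x‖ ^ 2 * ‖y‖ ^ 2 ≠ 0 :=
    (lt_of_lt_of_le (pow_pos (sub_pos.2 hxy) 2) (mobius_denom_ge n x y)).ne'
  have ha : 1 - ‖x‖ ^ 2 ≠ 0 := by nlinarith [norm_nonneg x]
  have hw := norm_mobiusT_sq n x y hD
  have hi := inner_mobiusT n x y
  have hyx : ‖y - x‖ ^ 2 = ‖y‖ ^ 2 - 2 * inner ℝ x y + ‖x‖ ^ 2 := by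
    rw [norm_sub_sq_real, real_inner_comm]
  rw [hyx] at hw
  rw [mobiusT_eq n (-x), norm_neg, inner_neg_left, hw, hi, mobiusT_eq]
  set a := ‖x‖ ^ 2
  set b := ‖y‖ ^ 2
  set c : ℝ := inner ℝ x y
  have hE : 1 - 2 * -(((1 - a) * c - (1 + b - 2 * c) * a) / (1 - 2 * c + a * b)) +
      a * ((b - 2 * c + a) / (1 - 2 * c + a * b)) = (1 - a) ^ 2 / (1 - 2 * c + a * b) := by
    field_simp
    ring
  rw [hE]
  match_scalars
  · field_simp
  · field_simp
    ring

theorem norm_mobiusT_le (n : ℕ) {x y : Vec n} {k : ℝ} (hk : 0 ≤ k) (hx : ‖x‖ < 1)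
    (hy : ‖y‖ < 1) (hxy : ‖y - x‖ ≤ k * (1 - ‖x‖)) : ‖mobiusT n x y‖ ≤ k := by
  have h1 : 1 - ‖x‖ ≤ 1 - ‖x‖ * ‖y‖ := by nlinarith [norm_nonneg x, norm_nonneg y]
  have h2 : (1 - ‖x‖) ^ 2 ≤ 1 - 2 * inner ℝ x y + ‖x‖ ^ 2 * ‖y‖ ^ 2 :=
    (pow_le_pow_left₀ (by linarith) h1 2).trans (mobius_denom_ge n x y)
  have hD : 0 < 1 - 2 * inner ℝ x y + ‖x‖ ^ 2 * ‖y‖ ^ 2 :=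
    lt_of_lt_of_le (pow_pos (sub_pos.2 hx) 2) h2
  refine le_of_sq_le_sq ?_ hk
  rw [norm_mobiusT_sq n x y hD.ne', div_le_iff₀ hD]
  calc ‖y - x‖ ^ 2 ≤ (k * (1 - ‖x‖)) ^ 2 := pow_le_pow_left₀ (norm_nonneg _) hxy 2
    _ = k ^ 2 * (1 - ‖x‖) ^ 2 := by ring
    _ ≤ _ := by gcongr

theorem InMiniowitz.bounds_of_mem_ball {n : ℕ} {C₀ α : ℝ} {f : Vec n → Vec n}
    (hMin : InMiniowitz n C₀ α f) (hC₀ : 0 ≤ C₀) (hα : 0 ≤ α) {k : ℝ} (hk0 : 0 ≤ k) (hk1 : k < 1)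
    {x y : Vec n} (hx : x ∈ unitBall n) (hy : y ∈ Metric.ball x (k * (1 - ‖x‖))) :
    y ∈ unitBall n ∧ C₀⁻¹ * ((1 - k) / (1 + k)) ^ α ≤ ‖f y‖ / ‖f x‖ ∧
      ‖f y‖ / ‖f x‖ ≤ C₀ * ((1 + k) / (1 - k)) ^ α := by
  have hx1 : ‖x‖ < 1 := by simpa [unitBall] using hx
  have hyx : ‖y - x‖ < k * (1 - ‖x‖) := by simpa [dist_eq_norm] using hy
  have hy1 : ‖y‖ < 1 := by
    have := norm_le_norm_add_norm_sub' y x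
    nlinarith
  have ht := norm_mobiusT_le n hk0 hx1 hy1 hyx.le
  have h := hMin x hx (mobiusT n x y) (by simpa [unitBall] using ht.trans_lt hk1)
  rw [mobiusT_neg_mobiusT n hx1 hy1, mobiusT_zero_right, neg_neg] at h
  have ht0 := norm_nonneg (mobiusT n x y)
  refine ⟨by simpa [unitBall] using hy1, le_trans ?_ h.1, h.2.trans ?_⟩
  · have : 0 ≤ (1 - k) / (1 + k) := div_nonneg (by linarith) (by linarith)
    gcongr
    linarith
  · have h1 : 0 < 1 - k := by linarith
    have h2 : 0 ≤ (1 + ‖mobiusT n x y‖) / (1 - ‖mobiusT n x y‖) :=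
      div_nonneg (by linarith) (by linarith)
    gcongr

theorem harnack_const_le {k : ℝ} (hk0 : 0 < k) (hk : k < (Real.sqrt 5 - 1) / 2) :
    k < 1 ∧ 0 < 1 - k * (k + 1) ∧
      ((1 + k) / (1 - k)) ^ 2 ≤ 2 / (1 - k * (k + 1)) ^ 2 := by
  have h5 : Real.sqrt 5 ^ 2 = 5 := Real.sq_sqrt (by norm_num)
  have hpos : 0 < 1 - k * (k + 1) := by nlinarith
  have hk1 : k < 1 := by nlinarith
  refine ⟨hk1, hpos, ?_⟩
  have h : (1 + k) * (1 - k * (k + 1)) ≤ 7 / 5 * (1 - k) := by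
    nlinarith [sq_nonneg (20 * k - 7), pow_pos hk0 3]
  have h1k : 0 < 1 - k := by linarith
  rw [div_pow, div_le_div_iff₀ (by positivity) (by positivity), ← mul_pow]
  calc ((1 + k) * (1 - k * (k + 1))) ^ 2 ≤ (7 / 5 * (1 - k)) ^ 2 :=
        pow_le_pow_left₀ (by positivity) h 2
    _ ≤ 2 * (1 - k) ^ 2 := by nlinarith [sq_nonneg (1 - k)]

theorem harnack_inequality_qr (n : ℕ) (hn : 2 ≤ n) (K C₀ α : ℝ) (hK : 1 ≤ K)
    (hC₀ : 1 ≤ C₀) (hα : 0 < α)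
    (f : Vec n → Vec n) (hf : IsQR n K f) (hf0 : ∀ x ∈ unitBall n, f x ≠ 0)
    (hMin : InMiniowitz n C₀ α f) :
    ∀ k : ℝ, 0 < k → k < (Real.sqrt 5 - 1) / 2 →
      ∀ x ∈ unitBall n, ∀ y ∈ Metric.ball x (k * (1 - ‖x‖)),
        ∀ z ∈ Metric.ball x (k * (1 - ‖x‖)),
          ‖f y‖ / ‖f z‖ ≤ (2 : ℝ) ^ α * C₀ ^ 2 / (1 - k * (k + 1)) ^ (2 * α) := by
  intro k hk0 hk x hx y hy z hz
  obtain ⟨hk1, hpos, hconst⟩ := harnack_const_le hk0 hk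
  have hC : 0 < C₀ := by linarith
  obtain ⟨-, -, hyu⟩ := hMin.bounds_of_mem_ball hC.le hα.le hk0.le hk1 hx hy
  obtain ⟨-, hzl, -⟩ := hMin.bounds_of_mem_ball hC.le hα.le hk0.le hk1 hx hz
  have hfx : 0 < ‖f x‖ := norm_pos_iff.2 (hf0 x hx)
  have h1k : 0 < 1 - k := by linarith
  set q := (1 + k) / (1 - k) with hq
  have hq0 : 0 < q := by positivity
  have hinv : (1 - k) / (1 + k) = q⁻¹ := by rw [hq, inv_div]
  rw [hinv, Real.inv_rpow hq0.le] at hzl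
  have hqα : 0 < q ^ α := Real.rpow_pos_of_pos hq0 α
  calc ‖f y‖ / ‖f z‖ = (‖f y‖ / ‖f x‖) / (‖f z‖ / ‖f x‖) := by
        rw [div_div_div_cancel_right₀ hfx.ne']
    _ ≤ (C₀ * q ^ α) / (C₀⁻¹ * (q ^ α)⁻¹) := by gcongr
    _ = C₀ ^ 2 * (q ^ 2) ^ α := by
        rw [pow_two q, Real.mul_rpow hq0.le hq0.le]
        field_simp
    _ ≤ C₀ ^ 2 * (2 / (1 - k * (k + 1)) ^ 2) ^ α := by gcongr
    _ = _ := by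
        rw [Real.div_rpow (by norm_num) (by positivity), Real.rpow_mul hpos.le]
        norm_num
        ring

end
end
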